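/- Let 1 < p < ∞ and set δ := 2/(e^π + 1). For all a_1,…,a_N ∈ ℂ and all pairwise disjoint Borel sets A_1,…,A_N ⊆ (−1,1), one has ‖(Σ_{n=1}^N |a_n|² |T(χ_{A_n})|²)^{1/2}‖_{L^p(−1,1)} ≥ δ^{1/p}·‖Σ_{n=1}^N a_n χ_{A_n}‖_{L^p(−1,1)}. -/

import Mathlib

open MeasureTheory Filter Set
open scoped Classical

/-- The finite Hilbert transform of `f ∈ L¹(-1,1)`:
`(T f)(t) = lim_{ε→0⁺} (1/π) (∫_{-1}^{t-ε} + ∫_{t+ε}^{1}) f(x)/(x-t) dx`,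
defined to be `0` at points where the limit does not exist. -/
noncomputable def finiteHilbertT (f : ℝ → ℂ) (t : ℝ) : ℂ :=
  if h : ∃ L : ℂ, Tendsto (fun ε : ℝ =>
      (Real.pi : ℂ)⁻¹ * ((∫ x in (-1:ℝ)..(t - ε), f x / ((x : ℂ) - (t : ℂ))) +
        (∫ x in (t + ε)..(1:ℝ), f x / ((x : ℂ) - (t : ℂ)))))
      (nhdsWithin 0 (Set.Ioi 0)) (nhds L)
  then h.choose else 0

/-- Lebesgue measure on the interval `(-1,1)`. -/
noncomputable def m11 : Measure ℝ := volume.restrict (Set.Ioo (-1 : ℝ) 1)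

section Boole

variable {ι : Type*}

theorem ae_forall_ne (s : Finset ι) (a : ι → ℝ) : ∀ᵐ x : ℝ, ∀ i ∈ s, x ≠ a i := by
  have hfin : (a '' s).Finite := s.finite_toSet.image a
  have h0 : ∀ᵐ x : ℝ, x ∉ a '' s := hfin.measure_zero volume |> measure_eq_zero_iff_ae_notMem.1
  filter_upwards [h0] with x hx i hi h
  exact hx ⟨i, hi, h.symm⟩

theorem tendsto_sum_div_sub_nhdsGT (s : Finset ι) (a c : ι → ℝ) (ha : Set.InjOn a s)
    {i : ι} (hi : i ∈ s) (hc : 0 < c i) :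
    Tendsto (fun x => ∑ j ∈ s, c j / (x - a j)) (nhdsWithin (a i) (Ioi (a i))) atTop := by
  have h1 : (fun x => ∑ j ∈ s, c j / (x - a j)) =
      fun x => c i / (x - a i) + ∑ j ∈ s.erase i, c j / (x - a j) := by
    ext x
    rw [Finset.add_sum_erase s (fun j => c j / (x - a j)) hi]
  rw [h1]
  have h2 : ContinuousAt (fun x => ∑ j ∈ s.erase i, c j / (x - a j)) (a i) := by
    refine tendsto_finsetSum _ fun j hj => ?_
    have hne : a i - a j ≠ 0 := by
      intro h
      exact (Finset.ne_of_mem_erase hj) (ha (Finset.mem_of_mem_erase hj) hi (by linarith))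
    exact ContinuousAt.div (by fun_prop) (by fun_prop) hne
  refine Tendsto.atTop_add ?_ (h2.tendsto.mono_left nhdsWithin_le_nhds)
  simp_rw [div_eq_mul_inv]
  refine Tendsto.const_mul_atTop hc (tendsto_inv_nhdsGT_zero.comp ?_)
  refine tendsto_nhdsWithin_iff.2 ⟨?_, ?_⟩
  · have : Tendsto (fun x => x - a i) (nhds (a i)) (nhds (a i - a i)) :=
      (continuous_id.sub continuous_const).tendsto _
    rw [sub_self] at this
    exact this.mono_left nhdsWithin_le_nhds
  · filter_upwards [self_mem_nhdsWithin] with x hx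
    simpa using hx

theorem tendsto_sum_div_sub_nhdsLT (s : Finset ι) (a c : ι → ℝ) (ha : Set.InjOn a s)
    {i : ι} (hi : i ∈ s) (hc : 0 < c i) :
    Tendsto (fun x => ∑ j ∈ s, c j / (x - a j)) (nhdsWithin (a i) (Iio (a i))) atBot := by
  have h := tendsto_sum_div_sub_nhdsGT s (fun j => - a j) c
    (fun x hx y hy h => ha hx hy (neg_injective h)) hi hc
  have h2 := tendsto_neg_atTop_atBot.comp (h.comp (tendsto_neg_nhdsLT (a := a i)))
  refine h2.congr fun x => ?_
  simp only [Function.comp_apply, ← Finset.sum_neg_distrib]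
  refine Finset.sum_congr rfl fun j _ => ?_
  rw [← div_neg]
  congr 1
  ring

theorem sum_div_sub_lt_of_lt (s : Finset ι) (hs : s.Nonempty) (a c : ι → ℝ)
    (hc : ∀ i ∈ s, 0 < c i) {x y : ℝ} (hxy : x < y) (h : ∀ j ∈ s, a j < x ∨ y < a j) :
    ∑ j ∈ s, c j / (y - a j) < ∑ j ∈ s, c j / (x - a j) := by
  refine Finset.sum_lt_sum_of_nonempty hs fun j hj => ?_
  rcases h j hj with h | h
  · exact div_lt_div_of_pos_left (hc j hj) (by linarith) (by linarith)
  · rw [← neg_sub (a j) y, ← neg_sub (a j) x, div_neg, div_neg, neg_lt_neg_iff]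
    exact div_lt_div_of_pos_left (hc j hj) (by linarith) (by linarith)

theorem exists_sum_div_sub_eq (s : Finset ι) (a c : ι → ℝ) (ha : Set.InjOn a s)
    (hc : ∀ i ∈ s, 0 < c i) {l : ℝ} (hl : 0 < l) {i : ι} (hi : i ∈ s) :
    ∃ r, a i < r ∧ (∀ j ∈ s, a j ≤ a i ∨ r < a j) ∧ ∑ j ∈ s, c j / (r - a j) = l := by
  have htop := tendsto_sum_div_sub_nhdsGT s a c ha hi (hc i hi)
  have hcont : ∀ t : Set ℝ, (∀ x ∈ t, ∀ j ∈ s, x ≠ a j) →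
      ContinuousOn (fun x => ∑ j ∈ s, c j / (x - a j)) t := by
    intro t ht
    refine continuousOn_finsetSum _ fun j hj => ?_
    exact ContinuousOn.div (by fun_prop) (by fun_prop)
      fun x hx => sub_ne_zero.2 (ht x hx j hj)
  by_cases hne : (s.filter fun j => a i < a j).Nonempty
  · obtain ⟨k, hk, hmin⟩ := Finset.exists_min_image _ a hne
    obtain ⟨hks, hik⟩ := Finset.mem_filter.1 hk
    have hgap : ∀ x ∈ Ioo (a i) (a k), ∀ j ∈ s, a j ≤ a i ∨ x < a j := by
      intro x hx j hj
      by_cases hji : a j ≤ a i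
      · exact Or.inl hji
      · exact Or.inr (hx.2.trans_le (hmin j (Finset.mem_filter.2 ⟨hj, not_le.1 hji⟩)))
    have hbot := tendsto_sum_div_sub_nhdsLT s a c ha hks (hc k hks)
    have := (isPreconnected_Ioo (a := a i) (b := a k)).intermediate_value_Iii
      (l₁ := nhdsWithin (a k) (Iio (a k))) (l₂ := nhdsWithin (a i) (Ioi (a i)))
      (le_principal_iff.2 (Ioo_mem_nhdsLT hik)) (le_principal_iff.2 (Ioo_mem_nhdsGT hik))
      (hcont _ fun x hx j hj => by
        rcases hgap x hx j hj with h | h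
        · exact (h.trans_lt hx.1).ne'
        · exact h.ne) hbot htop
    obtain ⟨r, hr, hrl⟩ := this (mem_univ l)
    exact ⟨r, hr.1, hgap r hr, hrl⟩
  · have hgap : ∀ j ∈ s, a j ≤ a i := by
      intro j hj
      by_contra h
      exact hne ⟨j, Finset.mem_filter.2 ⟨hj, not_le.1 h⟩⟩
    have hzero : Tendsto (fun x => ∑ j ∈ s, c j / (x - a j)) atTop (nhds 0) := by
      have : Tendsto (fun x => ∑ j ∈ s, c j / (x - a j)) atTop (nhds (∑ j ∈ s, 0)) := by
        refine tendsto_finsetSum _ fun j _ => ?_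
        exact tendsto_const_nhds.div_atTop (tendsto_atTop_add_const_right _ (-a j) tendsto_id)
      simpa using this
    have := (isPreconnected_Ioi (a := a i)).intermediate_value_Ioi
      (l₁ := atTop) (l₂ := nhdsWithin (a i) (Ioi (a i)))
      (le_principal_iff.2 (Ioi_mem_atTop _)) (le_principal_iff.2 self_mem_nhdsWithin)
      (hcont _ fun x hx j hj => ((hgap j hj).trans_lt hx).ne') hzero htop
    obtain ⟨r, hr, hrl⟩ := this hl
    exact ⟨r, hr, fun j hj => Or.inl (hgap j hj), hrl⟩

theorem sum_roots_sum_div_sub (s : Finset ι) (a c r : ι → ℝ) {l : ℝ} (hl : 0 < l)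
    (hr : Set.InjOn r s) (hra : ∀ i ∈ s, ∀ j ∈ s, r i ≠ a j)
    (hroot : ∀ i ∈ s, ∑ j ∈ s, c j / (r i - a j) = l) :
    ∑ i ∈ s, (r i - a i) = (∑ i ∈ s, c i) / l := by
  open Polynomial in
  rcases s.eq_empty_or_nonempty with rfl | hs
  · simp
  have hcard : 0 < s.card := hs.card_pos
  set Q : ℝ[X] := ∑ j ∈ s, C (c j) * ∏ k ∈ s.erase j, (X - C (a k)) with hQ
  have hQdeg : Q.degree < s.card := by
    refine (degree_sum_le _ _).trans_lt ?_
    rw [Finset.sup_lt_iff (by exact_mod_cast WithBot.bot_lt_coe _)]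
    intro j hj
    rw [← smul_eq_C_mul]
    refine (degree_smul_le _ _).trans_lt ?_
    rw [degree_prod]
    simp only [degree_X_sub_C, Finset.sum_const, Finset.card_erase_of_mem hj, nsmul_eq_mul, mul_one]
    exact_mod_cast Nat.sub_lt hcard one_pos
  have hQcoeff : Q.coeff (s.card - 1) = ∑ j ∈ s, c j := by
    rw [hQ, finsetSum_coeff]
    refine Finset.sum_congr rfl fun j hj => ?_
    have hm : (∏ k ∈ s.erase j, (X - C (a k))).Monic :=
      monic_prod_of_monic _ _ fun k _ => monic_X_sub_C _
    have hd : (∏ k ∈ s.erase j, (X - C (a k))).natDegree = s.card - 1 := by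
      rw [natDegree_prod_of_monic _ _ fun k _ => monic_X_sub_C _]
      simp [Finset.card_erase_of_mem hj]
    rw [coeff_C_mul, ← hd, hm.coeff_natDegree, mul_one]
  have hmain : C l * ∏ i ∈ s, (X - C (a i)) - Q = C l * ∏ i ∈ s, (X - C (r i)) := by
    refine eq_of_degree_sub_lt_of_eval_index_eq s hr ?_ ?_
    · have hsub : (∏ i ∈ s, (X - C (a i)) - ∏ i ∈ s, (X - C (r i)) : ℝ[X]).degree < s.card := by
        have hd : ∀ f : ι → ℝ, (∏ i ∈ s, (X - C (f i)) : ℝ[X]).degree = (s.card : WithBot ℕ) := by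
          intro f
          rw [degree_prod]; simp
        have := degree_sub_lt_left (p := ∏ i ∈ s, (X - C (a i))) (q := ∏ i ∈ s, (X - C (r i)))
          (by rw [hd, hd]) (Monic.ne_zero (monic_prod_of_monic _ _ fun k _ => monic_X_sub_C _))
          (by rw [Monic.leadingCoeff (monic_prod_of_monic _ _ fun k _ => monic_X_sub_C _),
            Monic.leadingCoeff (monic_prod_of_monic _ _ fun k _ => monic_X_sub_C _)])
        rwa [hd] at this
      rw [show C l * ∏ i ∈ s, (X - C (a i)) - Q - C l * ∏ i ∈ s, (X - C (r i)) =
        C l * (∏ i ∈ s, (X - C (a i)) - ∏ i ∈ s, (X - C (r i))) - Q by ring]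
      rw [← smul_eq_C_mul]
      exact (degree_sub_le _ _).trans_lt (max_lt ((degree_smul_le _ _).trans_lt hsub) hQdeg)
    · intro i hi
      have h0 : ∏ k ∈ s, (r i - r k) = 0 := Finset.prod_eq_zero hi (sub_self _)
      simp only [hQ, eval_sub, eval_mul, eval_C, eval_prod, eval_X, eval_finsetSum, h0, mul_zero]
      rw [← hroot i hi, Finset.sum_mul, ← Finset.sum_sub_distrib]
      refine Finset.sum_eq_zero fun j hj => ?_
      rw [← Finset.mul_prod_erase s (fun k => r i - a k) hj]
      have := sub_ne_zero.2 (hra i hi j hj)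
      field_simp
      ring
  have hco := congrArg (fun P => P.coeff (s.card - 1)) hmain
  simp only [coeff_sub, coeff_C_mul, hQcoeff, prod_X_sub_C_coeff_card_pred s _ hcard] at hco
  rw [Finset.sum_sub_distrib, eq_div_iff hl.ne']
  linarith

theorem volume_lt_sum_div_sub_of_pos (s : Finset ι) (a c : ι → ℝ) (ha : Set.InjOn a s)
    (hc : ∀ i ∈ s, 0 < c i) {l : ℝ} (hl : 0 < l) :
    volume {x | l < ∑ j ∈ s, c j / (x - a j)} = ENNReal.ofReal ((∑ i ∈ s, c i) / l) := by
  have hex : ∀ i, ∃ r, i ∈ s →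
      (a i < r ∧ (∀ j ∈ s, a j ≤ a i ∨ r < a j) ∧ ∑ j ∈ s, c j / (r - a j) = l) := by
    intro i
    by_cases hi : i ∈ s
    · obtain ⟨r, hr⟩ := exists_sum_div_sub_eq s a c ha hc hl hi
      exact ⟨r, fun _ => hr⟩
    · exact ⟨0, fun h => absurd h hi⟩
  choose r hr using hex
  have hlt : ∀ i ∈ s, ∀ j ∈ s, a i < a j → r i < a j := by
    intro i hi j hj hij
    rcases (hr i hi).2.1 j hj with h | h
    · exact absurd hij h.not_gt
    · exact h
  have hra : ∀ i ∈ s, ∀ j ∈ s, r i ≠ a j := by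
    intro i hi j hj
    rcases (hr i hi).2.1 j hj with h | h
    · exact (h.trans_lt (hr i hi).1).ne'
    · exact h.ne
  have hrinj : Set.InjOn r s := by
    intro i hi j hj hij
    by_contra hne
    have hane : a i ≠ a j := fun h => hne (ha hi hj h)
    rcases lt_or_gt_of_ne hane with h | h
    · have := hlt i hi j hj h
      have := (hr j hj).1
      linarith
    · have := hlt j hj i hi h
      have := (hr i hi).1
      linarith
  have hdisj : (s : Set ι).PairwiseDisjoint fun i => Ioo (a i) (r i) := by
    intro i hi j hj hne
    have hane : a i ≠ a j := fun h => hne (ha hi hj h)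
    refine Set.disjoint_left.2 fun x hxi hxj => ?_
    rcases lt_or_gt_of_ne hane with h | h
    · have := hlt i hi j hj h
      linarith [hxi.2, hxj.1]
    · have := hlt j hj i hi h
      linarith [hxi.1, hxj.2]
  have hsets : ∀ x, (∀ j ∈ s, x ≠ a j) →
      (l < ∑ j ∈ s, c j / (x - a j) ↔ x ∈ ⋃ i ∈ s, Ioo (a i) (r i)) := by
    intro x hx
    simp only [mem_iUnion, exists_prop]
    constructor
    · intro hlx
      have hne : (s.filter fun j => a j < x).Nonempty := by
        by_contra hemp
        rw [Finset.not_nonempty_iff_eq_empty] at hemp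
        have : ∑ j ∈ s, c j / (x - a j) ≤ 0 := by
          refine Finset.sum_nonpos fun j hj => ?_
          have : ¬ a j < x := fun h => by
            have : j ∈ s.filter fun j => a j < x := Finset.mem_filter.2 ⟨hj, h⟩
            simp [hemp] at this
          exact div_nonpos_of_nonneg_of_nonpos (hc j hj).le (by linarith)
        linarith
      obtain ⟨i, hi, hmax⟩ := Finset.exists_max_image _ a hne
      obtain ⟨his, hix⟩ := Finset.mem_filter.1 hi
      refine ⟨i, his, hix, ?_⟩
      by_contra hrx
      rcases (not_lt.1 hrx).eq_or_lt with h | h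
      · rw [← h, (hr i his).2.2] at hlx
        exact lt_irrefl _ hlx
      · have := sum_div_sub_lt_of_lt s ⟨i, his⟩ a c hc h (by
          intro j hj
          by_cases hjx : a j < x
          · exact Or.inl ((hmax j (Finset.mem_filter.2 ⟨hj, hjx⟩)).trans_lt (hr i his).1)
          · exact Or.inr (lt_of_le_of_ne (not_lt.1 hjx) (hx j hj)))
        rw [(hr i his).2.2] at this
        exact lt_asymm this hlx
    · rintro ⟨i, his, hix⟩
      have := sum_div_sub_lt_of_lt s ⟨i, his⟩ a c hc hix.2 (by
        intro j hj
        rcases (hr i his).2.1 j hj with h | h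
        · exact Or.inl (h.trans_lt hix.1)
        · exact Or.inr h)
      rwa [(hr i his).2.2] at this
  have hae : {x | l < ∑ j ∈ s, c j / (x - a j)} =ᵐ[volume] ⋃ i ∈ s, Ioo (a i) (r i) := by
    filter_upwards [ae_forall_ne s a] with x hx
    exact propext (hsets x hx)
  rw [measure_congr hae, measure_biUnion_finset hdisj fun _ _ => measurableSet_Ioo]
  simp only [Real.volume_Ioo]
  rw [← ENNReal.ofReal_sum_of_nonneg fun i hi => by linarith [(hr i hi).1],
    sum_roots_sum_div_sub s a c r hl hrinj hra fun i hi => (hr i hi).2.2]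

/-- Boole's identity for the distribution of a sum of simple poles with nonnegative residues. -/
theorem volume_lt_sum_div_sub (s : Finset ι) (a c : ι → ℝ) (ha : Set.InjOn a s)
    (hc : ∀ i ∈ s, 0 ≤ c i) {l : ℝ} (hl : 0 < l) :
    volume {x | l < ∑ j ∈ s, c j / (x - a j)} = ENNReal.ofReal ((∑ i ∈ s, c i) / l) := by
  have hfil : ∀ f : ι → ℝ, ∑ j ∈ s.filter (fun j => c j ≠ 0), c j * f j = ∑ j ∈ s, c j * f j := by
    intro f
    refine Finset.sum_filter_of_ne fun j _ h hcj => h (by rw [hcj, zero_mul])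
  have h := volume_lt_sum_div_sub_of_pos (s.filter fun j => c j ≠ 0) a c
    (ha.mono fun j hj => (Finset.mem_filter.1 hj).1)
    (fun i hi => lt_of_le_of_ne (hc i (Finset.mem_filter.1 hi).1) (Finset.mem_filter.1 hi).2.symm)
    hl
  simp only [div_eq_mul_inv, hfil] at h ⊢
  rw [h, Finset.sum_filter_ne_zero]

theorem volume_sum_div_sub_lt (s : Finset ι) (a c : ι → ℝ) (ha : Set.InjOn a s)
    (hc : ∀ i ∈ s, 0 ≤ c i) {l : ℝ} (hl : 0 < l) :
    volume {x | ∑ j ∈ s, c j / (x - a j) < -l} = ENNReal.ofReal ((∑ i ∈ s, c i) / l) := by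
  rw [← volume_lt_sum_div_sub s (fun j => - a j) c
    (fun x hx y hy h => ha hx hy (neg_injective h)) hc hl, ← Measure.measure_preimage_neg]
  congr 1
  ext x
  have : ∑ j ∈ s, c j / (-x - a j) = - ∑ j ∈ s, c j / (x - -a j) := by
    rw [← Finset.sum_neg_distrib]
    refine Finset.sum_congr rfl fun j _ => ?_
    rw [← div_neg]
    congr 1
    ring
  simp only [mem_preimage, mem_ofPred_eq, this, neg_lt_neg_iff]

end Boole

section Intervals

variable {ι : Type*}

/-- The logarithmic potential difference of a finite family of intervals `(a i, b i)`: off the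
endpoints it equals `π` times the Hilbert transform of the indicator of their union. -/
noncomputable def logRatioSum (s : Finset ι) (a b : ι → ℝ) (t : ℝ) : ℝ :=
  ∑ i ∈ s, (Real.log (b i - t) - Real.log (a i - t))

/-- The open intervals `(a i, b i)`, `i ∈ s`, are nonempty and pairwise disjoint. -/
structure SeparatedIntervals (s : Finset ι) (a b : ι → ℝ) : Prop where
  lt : ∀ i ∈ s, a i < b i
  sep : ∀ i ∈ s, ∀ j ∈ s, i ≠ j → b i ≤ a j ∨ b j ≤ a i

theorem SeparatedIntervals.injOn {s : Finset ι} {a b : ι → ℝ} (h : SeparatedIntervals s a b) :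
    Set.InjOn a s := by
  intro i hi j hj hij
  by_contra hne
  have h1 := h.lt i hi
  have h2 := h.lt j hj
  rcases h.sep i hi j hj hne with h3 | h3 <;> linarith

theorem SeparatedIntervals.neg {s : Finset ι} {a b : ι → ℝ} (h : SeparatedIntervals s a b) :
    SeparatedIntervals s (fun i => - b i) (fun i => - a i) := by
  refine ⟨fun i hi => neg_lt_neg (h.lt i hi), fun i hi j hj hij => ?_⟩
  rcases h.sep i hi j hj hij with h3 | h3
  · right; linarith
  · left; linarith

theorem SeparatedIntervals.subset {s t : Finset ι} {a b : ι → ℝ} (h : SeparatedIntervals s a b)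
    (hts : t ⊆ s) : SeparatedIntervals t a b :=
  ⟨fun i hi => h.lt i (hts hi), fun i hi j hj => h.sep i (hts hi) j (hts hj)⟩

theorem logRatioSum_neg (s : Finset ι) (a b : ι → ℝ) (t : ℝ) :
    logRatioSum s (fun i => - b i) (fun i => - a i) t = - logRatioSum s a b (-t) := by
  unfold logRatioSum
  rw [← Finset.sum_neg_distrib]
  refine Finset.sum_congr rfl fun i _ => ?_
  rw [← Real.log_neg_eq_log (-a i - t), ← Real.log_neg_eq_log (-b i - t)]
  ring_nf

theorem measurable_logRatioSum (s : Finset ι) (a b : ι → ℝ) :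
    Measurable (logRatioSum s a b) := by
  unfold logRatioSum
  fun_prop

theorem SeparatedIntervals.exists_partial_fractions {s : Finset ι} {a b : ι → ℝ}
    (h : SeparatedIntervals s a b) :
    ∃ c : ι → ℝ, (∀ i ∈ s, 0 ≤ c i) ∧ ∑ i ∈ s, c i = ∑ i ∈ s, (b i - a i) ∧
      ∀ x, (∀ i ∈ s, x ≠ a i) →
        ∏ i ∈ s, ((x - b i) / (x - a i)) = 1 - ∑ i ∈ s, c i / (x - a i) := by
  induction s using Finset.induction_on with
  | empty => exact ⟨0, by simp⟩
  | insert k s hk ih =>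
    obtain ⟨c, hc0, hcs, hcx⟩ := ih (h.subset (Finset.subset_insert k s))
    have hkk : k ∈ insert k s := Finset.mem_insert_self k s
    have hmem : ∀ i ∈ s, i ∈ insert k s := fun i hi => Finset.mem_insert_of_mem hi
    have hne : ∀ i ∈ s, i ≠ k := fun i hi hik => hk (hik ▸ hi)
    have hane : ∀ i ∈ s, a k ≠ a i := fun i hi hik =>
      hne i hi (h.injOn (hmem i hi) hkk hik.symm)
    refine ⟨fun i => if i = k then (b k - a k) * (1 - ∑ j ∈ s, c j / (a k - a j))
      else c i * ((a i - b k) / (a i - a k)), ?_, ?_, ?_⟩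
    · intro i hi
      rcases Finset.mem_insert.1 hi with rfl | his
      · simp only [if_true]
        refine mul_nonneg (by linarith [h.lt i hi]) ?_
        rw [← hcx (a i) hane]
        refine Finset.prod_nonneg fun j hj => ?_
        have h1 := h.lt j (hmem j hj)
        rcases h.sep j (hmem j hj) i hi (hne j hj) with h3 | h3
        · exact div_nonneg (by linarith) (by linarith)
        · have h2 := h.lt i hi
          exact div_nonneg_of_nonpos (by linarith) (by linarith)
      · simp only [if_neg (hne i his)]
        refine mul_nonneg (hc0 i his) ?_
        have h1 := h.lt i hi
        have h2 := h.lt k hkk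
        rcases h.sep i hi k hkk (hne i his) with h3 | h3
        · exact div_nonneg_of_nonpos (by linarith) (by linarith)
        · exact div_nonneg (by linarith) (by linarith)
    · rw [Finset.sum_insert hk, Finset.sum_insert hk, if_pos rfl, ← hcs]
      have : ∑ i ∈ s, (if i = k then (b k - a k) * (1 - ∑ j ∈ s, c j / (a k - a j))
          else c i * ((a i - b k) / (a i - a k))) =
          ∑ i ∈ s, c i + (b k - a k) * ∑ j ∈ s, c j / (a k - a j) := by
        rw [Finset.mul_sum, ← Finset.sum_add_distrib]
        refine Finset.sum_congr rfl fun i hi => ?_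
        rw [if_neg (hne i hi)]
        have h1 : a k - a i ≠ 0 := sub_ne_zero.2 (hane i hi)
        have h2 : a i - a k ≠ 0 := sub_ne_zero.2 (hane i hi).symm
        rw [show a k - a i = -(a i - a k) by ring]
        field_simp
        ring
      rw [this]
      ring
    · intro x hx
      have hxk : x - a k ≠ 0 := sub_ne_zero.2 (hx k hkk)
      beta_reduce
      rw [Finset.prod_insert hk, Finset.sum_insert hk, if_pos rfl,
        hcx x fun i hi => hx i (hmem i hi)]
      have : ∑ i ∈ s, (if i = k then (b k - a k) * (1 - ∑ j ∈ s, c j / (a k - a j))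
          else c i * ((a i - b k) / (a i - a k))) / (x - a i) =
          (x - b k) / (x - a k) * ∑ i ∈ s, c i / (x - a i) +
          (b k - a k) / (x - a k) * ∑ j ∈ s, c j / (a k - a j) := by
        rw [Finset.mul_sum, Finset.mul_sum, ← Finset.sum_add_distrib]
        refine Finset.sum_congr rfl fun i hi => ?_
        rw [if_neg (hne i hi)]
        have h1 : a k - a i ≠ 0 := sub_ne_zero.2 (hane i hi)
        have h2 : a i - a k ≠ 0 := sub_ne_zero.2 (hane i hi).symm
        have h3 : x - a i ≠ 0 := sub_ne_zero.2 (hx i (hmem i hi))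
        rw [show a k - a i = -(a i - a k) by ring]
        field_simp
        ring
      rw [this]
      field_simp
      ring

theorem logRatioSum_eq_log_prod {s : Finset ι} {a b : ι → ℝ} {x : ℝ}
    (ha : ∀ i ∈ s, x ≠ a i) (hb : ∀ i ∈ s, x ≠ b i) :
    logRatioSum s a b x = Real.log (∏ i ∈ s, ((x - b i) / (x - a i))) := by
  have h1 := fun i hi => sub_ne_zero.2 (ha i hi)
  have h2 := fun i hi => sub_ne_zero.2 (hb i hi)
  rw [Real.log_prod fun i hi => div_ne_zero (h2 i hi) (h1 i hi)]
  refine Finset.sum_congr rfl fun i hi => ?_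
  rw [Real.log_div (h2 i hi) (h1 i hi), ← Real.log_neg_eq_log (x - b i),
    ← Real.log_neg_eq_log (x - a i), neg_sub, neg_sub]

theorem mem_iUnion_Ioo_of_prod_neg {s : Finset ι} {a b : ι → ℝ} (hlt : ∀ i ∈ s, a i < b i) {x : ℝ}
    (h : ∏ i ∈ s, ((x - b i) / (x - a i)) < 0) : x ∈ ⋃ i ∈ s, Ioo (a i) (b i) := by
  by_contra hx
  simp only [mem_iUnion, exists_prop, not_exists, not_and] at hx
  refine absurd h (not_lt.2 (Finset.prod_nonneg fun i hi => ?_))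
  have h1 := hlt i hi
  by_cases h2 : a i < x
  · have : b i ≤ x := not_lt.1 fun h3 => hx i hi ⟨h2, h3⟩
    exact div_nonneg (by linarith) (by linarith)
  · exact div_nonneg_of_nonpos (by linarith) (by linarith)

theorem SeparatedIntervals.le_volume_lt_logRatioSum {s : Finset ι} {a b : ι → ℝ}
    (h : SeparatedIntervals s a b) (y : ℝ) :
    ENNReal.ofReal ((∑ i ∈ s, (b i - a i)) / (Real.exp y + 1)) ≤
      volume {x | x ∈ (⋃ i ∈ s, Ioo (a i) (b i)) ∧ y < logRatioSum s a b x} := by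
  obtain ⟨c, hc0, hcs, hcx⟩ := h.exists_partial_fractions
  rw [← hcs, ← volume_lt_sum_div_sub s a c h.injOn hc0 (by positivity)]
  refine measure_mono_ae ?_
  filter_upwards [ae_forall_ne s a, ae_forall_ne s b] with x hxa hxb hx
  have hx' : Real.exp y + 1 < ∑ i ∈ s, c i / (x - a i) := hx
  have hr : ∏ i ∈ s, ((x - b i) / (x - a i)) < -Real.exp y := by
    rw [hcx x hxa]; linarith
  have hpos := Real.exp_pos y
  refine ⟨mem_iUnion_Ioo_of_prod_neg h.lt (by linarith), ?_⟩
  rw [logRatioSum_eq_log_prod hxa hxb, ← Real.log_neg_eq_log, Real.lt_log_iff_exp_lt (by linarith)]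
  linarith

theorem SeparatedIntervals.volume_lt_logRatioSum_le {s : Finset ι} {a b : ι → ℝ}
    (h : SeparatedIntervals s a b) {y : ℝ} (hy : 0 < y) :
    volume {x | y < logRatioSum s a b x} ≤
      2 * ENNReal.ofReal ((∑ i ∈ s, (b i - a i)) / (Real.exp y - 1)) := by
  obtain ⟨c, hc0, hcs, hcx⟩ := h.exists_partial_fractions
  have hexp : 0 < Real.exp y - 1 := by linarith [Real.add_one_lt_exp hy.ne']
  rw [← hcs, two_mul]
  nth_rewrite 1 [← volume_lt_sum_div_sub s a c h.injOn hc0 hexp]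
  rw [← volume_sum_div_sub_lt s a c h.injOn hc0 hexp]
  refine (measure_mono_ae ?_).trans (measure_union_le _ _)
  filter_upwards [ae_forall_ne s a, ae_forall_ne s b] with x hxa hxb hx
  have hx' : y < logRatioSum s a b x := hx
  rw [logRatioSum_eq_log_prod hxa hxb, ← Real.log_abs, Real.lt_log_iff_exp_lt, hcx x hxa,
    lt_abs] at hx'
  · rcases hx' with hx' | hx'
    · right
      show ∑ i ∈ s, c i / (x - a i) < _
      linarith
    · left
      show _ < ∑ i ∈ s, c i / (x - a i)
      linarith
  · rw [abs_pos]
    exact Finset.prod_ne_zero_iff.2 fun i hi =>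
      div_ne_zero (sub_ne_zero.2 (hxb i hi)) (sub_ne_zero.2 (hxa i hi))

theorem SeparatedIntervals.le_volume_logRatioSum_lt {s : Finset ι} {a b : ι → ℝ}
    (h : SeparatedIntervals s a b) (y : ℝ) :
    ENNReal.ofReal ((∑ i ∈ s, (b i - a i)) / (Real.exp y + 1)) ≤
      volume {x | x ∈ (⋃ i ∈ s, Ioo (a i) (b i)) ∧ logRatioSum s a b x < -y} := by
  have h1 := h.neg.le_volume_lt_logRatioSum y
  rw [← Measure.measure_preimage_neg] at h1
  convert h1 using 3
  · refine Finset.sum_congr rfl fun i _ => by ring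
  · ext x
    simp only [mem_preimage, mem_ofPred_eq, logRatioSum_neg, neg_neg, mem_iUnion, mem_Ioo,
      neg_lt_neg_iff, exists_prop]
    refine and_congr ?_ ⟨fun h => by linarith, fun h => by linarith⟩
    exact exists_congr fun i => and_congr_right fun _ => and_comm

theorem SeparatedIntervals.le_volume_le_abs_logRatioSum {s : Finset ι} {a b : ι → ℝ}
    (h : SeparatedIntervals s a b) {y : ℝ} (hy : 0 ≤ y) :
    ENNReal.ofReal (2 / (Real.exp y + 1) * ∑ i ∈ s, (b i - a i)) ≤
      volume {x | x ∈ (⋃ i ∈ s, Ioo (a i) (b i)) ∧ y ≤ |logRatioSum s a b x|} := by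
  have h0 : 0 ≤ ∑ i ∈ s, (b i - a i) :=
    Finset.sum_nonneg fun i hi => by linarith [h.lt i hi]
  have hU : MeasurableSet (⋃ i ∈ s, Ioo (a i) (b i)) :=
    Finset.measurableSet_biUnion s fun _ _ => measurableSet_Ioo
  calc _ = ENNReal.ofReal ((∑ i ∈ s, (b i - a i)) / (Real.exp y + 1)) +
        ENNReal.ofReal ((∑ i ∈ s, (b i - a i)) / (Real.exp y + 1)) := by
        rw [← ENNReal.ofReal_add (by positivity) (by positivity)]
        congr 1
        ring
    _ ≤ _ := add_le_add (h.le_volume_lt_logRatioSum y) (h.le_volume_logRatioSum_lt y)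
    _ = volume ({x | x ∈ (⋃ i ∈ s, Ioo (a i) (b i)) ∧ y < logRatioSum s a b x} ∪
          {x | x ∈ (⋃ i ∈ s, Ioo (a i) (b i)) ∧ logRatioSum s a b x < -y}) := by
        rw [measure_union]
        · refine Set.disjoint_left.2 fun x hx hx' => ?_
          have h1 : y < logRatioSum s a b x := hx.2
          have h2 : logRatioSum s a b x < -y := hx'.2
          linarith
        · exact hU.inter (measurableSet_lt (measurable_logRatioSum s a b) measurable_const)
    _ ≤ _ := by
        refine measure_mono ?_
        rintro x (hx | hx)
        · exact ⟨hx.1, le_abs.2 (Or.inl hx.2.le)⟩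
        · exact ⟨hx.1, le_abs.2 (Or.inr (by linarith [hx.2]))⟩

theorem SeparatedIntervals.volume_lt_abs_logRatioSum_le {s : Finset ι} {a b : ι → ℝ}
    (h : SeparatedIntervals s a b) {y : ℝ} (hy : 0 < y) :
    volume {x | y < |logRatioSum s a b x|} ≤
      ENNReal.ofReal (8 * (∑ i ∈ s, (b i - a i)) * y ^ (-2 : ℝ)) := by
  have h0 : 0 ≤ ∑ i ∈ s, (b i - a i) :=
    Finset.sum_nonneg fun i hi => by linarith [h.lt i hi]
  have hq : y ^ 2 / 2 ≤ Real.exp y - 1 := by linarith [Real.quadratic_le_exp_of_nonneg hy.le]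
  have hexp : 0 < Real.exp y - 1 := lt_of_lt_of_le (by positivity) hq
  have h1 := h.volume_lt_logRatioSum_le hy
  have h2 := h.neg.volume_lt_logRatioSum_le hy
  rw [← Measure.measure_preimage_neg] at h2
  have hsub : {x | y < |logRatioSum s a b x|} ⊆ {x | y < logRatioSum s a b x} ∪
      (Neg.neg ⁻¹' {x | y < logRatioSum s (fun i => - b i) (fun i => - a i) x}) := by
    intro x hx
    have hx' : y < |logRatioSum s a b x| := hx
    rcases lt_abs.1 hx' with hx | hx
    · exact Or.inl hx
    · refine Or.inr ?_
      simpa only [mem_preimage, mem_ofPred_eq, logRatioSum_neg, neg_neg] using hx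
  have hsum : ∑ i ∈ s, (-a i - -b i) = ∑ i ∈ s, (b i - a i) :=
    Finset.sum_congr rfl fun i _ => by ring
  rw [hsum] at h2
  refine (measure_mono hsub).trans ((measure_union_le _ _).trans ((add_le_add h1 h2).trans ?_))
  rw [← two_mul, ← mul_assoc, show (2 * 2 : ENNReal) = ENNReal.ofReal 4 by norm_num,
    ← ENNReal.ofReal_mul (by norm_num)]
  refine ENNReal.ofReal_le_ofReal ?_
  rw [Real.rpow_neg hy.le, Real.rpow_ofNat]
  calc 4 * ((∑ i ∈ s, (b i - a i)) / (Real.exp y - 1))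
      ≤ 4 * ((∑ i ∈ s, (b i - a i)) / (y ^ 2 / 2)) := by gcongr
    _ = _ := by field_simp; ring

theorem SeparatedIntervals.lintegral_abs_logRatioSum_le {s : Finset ι} {a b : ι → ℝ}
    (h : SeparatedIntervals s a b) {C : ℝ} (hC : 0 < C) (hsC : ∑ i ∈ s, (b i - a i) ≤ C ^ 2) :
    ∫⁻ x in Ioo (-1 : ℝ) 1, ENNReal.ofReal |logRatioSum s a b x| ≤ ENNReal.ofReal (10 * C) := by
  rw [lintegral_eq_lintegral_meas_lt _ (Eventually.of_forall fun x => abs_nonneg _)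
    (measurable_logRatioSum s a b).abs.aemeasurable,
    ← Ioc_union_Ioi_eq_Ioi hC.le, lintegral_union measurableSet_Ioi
      (Ioc_disjoint_Ioi le_rfl), show 10 * C = 2 * C + 8 * C by ring,
    ENNReal.ofReal_add (by positivity) (by positivity)]
  refine add_le_add ?_ ?_
  · calc ∫⁻ t in Ioc 0 C, (volume.restrict (Ioo (-1 : ℝ) 1)) {x | t < |logRatioSum s a b x|}
        ≤ ∫⁻ t in Ioc 0 C, 2 := by
          refine lintegral_mono fun t => (measure_mono (subset_univ _)).trans ?_
          rw [Measure.restrict_apply_univ, Real.volume_Ioo]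
          norm_num
      _ = ENNReal.ofReal (2 * C) := by
          rw [setLIntegral_const, Real.volume_Ioc, sub_zero, ENNReal.ofReal_mul (by norm_num)]
          norm_num
  · calc ∫⁻ t in Ioi C, (volume.restrict (Ioo (-1 : ℝ) 1)) {x | t < |logRatioSum s a b x|}
        ≤ ∫⁻ t in Ioi C, ENNReal.ofReal (8 * C ^ 2 * t ^ (-2 : ℝ)) := by
          refine setLIntegral_mono' measurableSet_Ioi fun t ht => ?_
          have ht0 : 0 < t := hC.trans ht
          refine (Measure.restrict_apply_le _ _).trans
            ((h.volume_lt_abs_logRatioSum_le ht0).trans ?_)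
          refine ENNReal.ofReal_le_ofReal ?_
          gcongr
      _ = ENNReal.ofReal (8 * C) := by
          rw [← ofReal_integral_eq_lintegral_ofReal
            ((integrableOn_Ioi_rpow_of_lt (by norm_num) hC).const_mul _), integral_const_mul,
            integral_Ioi_rpow_of_lt (by norm_num) hC]
          · congr 1
            norm_num
            rw [Real.rpow_neg_one]
            field_simp
          · refine (ae_restrict_iff' measurableSet_Ioi).2 (Eventually.of_forall fun t ht => ?_)
            have ht0 : 0 < t := hC.trans ht
            positivity

end Intervals

section Kernel

theorem intervalIntegrable_log_sub_left (b x y : ℝ) :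
    IntervalIntegrable (fun t => Real.log (b - t)) volume x y := by
  simpa using (intervalIntegral.intervalIntegrable_log' (a := b - x) (b := b - y)).comp_sub_left b

theorem intervalIntegrable_log_add_right (b x y : ℝ) :
    IntervalIntegrable (fun t => Real.log (t + b)) volume x y := by
  simpa using (intervalIntegral.intervalIntegrable_log' (a := x + b) (b := y + b)).comp_add_right b

/-- Up to the factor `(2 π h)⁻¹`, the average over a symmetric interval of length `2 h` of the
Hilbert kernel. -/
noncomputable def logKernel (h u : ℝ) : ℝ := Real.log (u + h) - Real.log (u - h)

theorem intervalIntegrable_logKernel (h x a b : ℝ) :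
    IntervalIntegrable (fun s => logKernel h (s - x)) volume a b := by
  unfold logKernel
  have h1 := intervalIntegrable_log_add_right (-x + h) a b
  have h2 := intervalIntegrable_log_add_right (-x - h) a b
  refine (h1.sub h2).congr fun s _ => ?_
  ring_nf

theorem integral_log_sub_log_eq (a b x h : ℝ) :
    ∫ t in (x - h)..(x + h), (Real.log (b - t) - Real.log (a - t)) =
      ∫ s in a..b, logKernel h (s - x) := by
  unfold logKernel
  have h1 : ∫ s in a..b, (Real.log (s - x + h) - Real.log (s - x - h)) =
      ∫ s in a..b, (Real.log (s + (-x + h)) - Real.log (s + (-x - h))) := by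
    refine intervalIntegral.integral_congr fun s _ => ?_
    ring_nf
  rw [h1, intervalIntegral.integral_sub (intervalIntegrable_log_sub_left _ _ _)
    (intervalIntegrable_log_sub_left _ _ _),
    intervalIntegral.integral_sub (intervalIntegrable_log_add_right _ _ _)
    (intervalIntegrable_log_add_right _ _ _),
    intervalIntegral.integral_comp_sub_left (fun u => Real.log u),
    intervalIntegral.integral_comp_sub_left (fun u => Real.log u),
    intervalIntegral.integral_comp_add_right (fun u => Real.log u),
    intervalIntegral.integral_comp_add_right (fun u => Real.log u)]
  simp only [integral_log]
  ring_nf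

end Kernel

section Grid

/-- The union of the half-open cells `[k / N, (k + 1) / N)` with `k ∈ S`. -/
def gridSet (N : ℕ) (S : Finset ℤ) : Set ℝ := ⋃ k ∈ S, Ico ((k : ℝ) / N) (((k : ℝ) + 1) / N)

/-- The logarithmic potential difference of a grid set. -/
noncomputable def gridLog (N : ℕ) (S : Finset ℤ) (t : ℝ) : ℝ :=
  logRatioSum S (fun k : ℤ => (k : ℝ) / N) (fun k : ℤ => ((k : ℝ) + 1) / N) t

variable {N : ℕ}

theorem mem_gridSet (hN : 0 < N) {S : Finset ℤ} {x : ℝ} : x ∈ gridSet N S ↔ ⌊x * N⌋ ∈ S := by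
  have hN' : (0 : ℝ) < N := by exact_mod_cast hN
  simp only [gridSet, mem_iUnion, exists_prop, mem_Ico, div_le_iff₀ hN', lt_div_iff₀ hN']
  constructor
  · rintro ⟨k, hk, h⟩
    rwa [Int.floor_eq_iff.2 h]
  · intro h
    exact ⟨_, h, Int.floor_le _, Int.lt_floor_add_one _⟩

theorem measurableSet_gridSet (N : ℕ) (S : Finset ℤ) : MeasurableSet (gridSet N S) :=
  Finset.measurableSet_biUnion S fun _ _ => measurableSet_Ico

theorem separatedIntervals_grid (hN : 0 < N) (S : Finset ℤ) :
    SeparatedIntervals S (fun k : ℤ => (k : ℝ) / N) (fun k : ℤ => ((k : ℝ) + 1) / N) := by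
  have hN' : (0 : ℝ) < N := by exact_mod_cast hN
  refine ⟨fun i _ => by gcongr; linarith, fun i _ j _ hij => ?_⟩
  rcases lt_or_gt_of_ne hij with h | h
  · left
    have : (i : ℝ) + 1 ≤ j := by exact_mod_cast h
    gcongr
  · right
    have : (j : ℝ) + 1 ≤ i := by exact_mod_cast h
    gcongr

theorem pairwiseDisjoint_grid (hN : 0 < N) (S : Finset ℤ) :
    (S : Set ℤ).PairwiseDisjoint fun k : ℤ => Ico ((k : ℝ) / N) (((k : ℝ) + 1) / N) := by
  intro i hi j hj hij
  refine Set.disjoint_left.2 fun x hx hx' => ?_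
  rcases (separatedIntervals_grid hN S).sep i hi j hj hij with h | h
  · exact absurd (hx.2.trans_le (h.trans hx'.1)) (lt_irrefl _)
  · exact absurd (hx'.2.trans_le (h.trans hx.1)) (lt_irrefl _)

theorem volume_gridSet (hN : 0 < N) (S : Finset ℤ) :
    volume (gridSet N S) =
      ENNReal.ofReal (∑ k ∈ S, (((k : ℝ) + 1) / N - (k : ℝ) / N)) := by
  rw [gridSet, measure_biUnion_finset (pairwiseDisjoint_grid hN S) fun _ _ => measurableSet_Ico,
    ENNReal.ofReal_sum_of_nonneg]
  · simp only [Real.volume_Ico]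
  · intro k hk
    have := (separatedIntervals_grid hN S).lt k hk
    linarith

theorem integral_gridLog (hN : 0 < N) (S : Finset ℤ) (x h : ℝ) :
    ∫ t in (x - h)..(x + h), gridLog N S t = ∫ s in gridSet N S, logKernel h (s - x) := by
  unfold gridLog logRatioSum gridSet
  rw [intervalIntegral.integral_finsetSum fun k _ => (intervalIntegrable_log_sub_left _ _ _).sub
    (intervalIntegrable_log_sub_left _ _ _), integral_biUnion_finset _
    (fun _ _ => measurableSet_Ico) (pairwiseDisjoint_grid hN S)]
  · refine Finset.sum_congr rfl fun k hk => ?_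
    rw [integral_log_sub_log_eq, intervalIntegral.integral_of_le
      ((separatedIntervals_grid hN S).lt k hk).le, integral_Ico_eq_integral_Ioc]
  · intro k hk
    rw [← integrableOn_Icc_iff_integrableOn_Ico, integrableOn_Icc_iff_integrableOn_Ioc,
      ← intervalIntegrable_iff_integrableOn_Ioc_of_le
      ((separatedIntervals_grid hN S).lt k hk).le]
    exact intervalIntegrable_logKernel _ _ _ _

theorem le_volume_gridLog (hN : 0 < N) (S : Finset ℤ) :
    ENNReal.ofReal (2 / (Real.exp Real.pi + 1)) * volume (gridSet N S) ≤
      volume {x | x ∈ gridSet N S ∧ Real.pi ≤ |gridLog N S x|} := by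
  have h := (separatedIntervals_grid hN S).le_volume_le_abs_logRatioSum Real.pi_pos.le
  rw [volume_gridSet hN, ← ENNReal.ofReal_mul (by positivity)]
  refine h.trans (measure_mono ?_)
  rintro x ⟨hx, hx'⟩
  refine ⟨?_, hx'⟩
  exact iUnion₂_mono (fun k _ => Ioo_subset_Ico_self) hx

theorem measurable_gridLog (N : ℕ) (S : Finset ℤ) : Measurable (gridLog N S) :=
  measurable_logRatioSum _ _ _

theorem exists_gridSet_refine (hN : 0 < N) {M : ℕ} (hM : 0 < M) (S : Finset ℤ) :
    ∃ S' : Finset ℤ, gridSet (N * M) S' = gridSet N S ∧ gridLog (N * M) S' = gridLog N S := by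
  have hM' : (0 : ℝ) < M := by exact_mod_cast hM
  have hN' : (0 : ℝ) < N := by exact_mod_cast hN
  have hMz : (0 : ℤ) < M := by exact_mod_cast hM
  set g : ℤ × ℕ → ℤ := fun p => p.1 * M + p.2 with hg
  have hdiv : ∀ j : ℤ, ∀ i ∈ Finset.range M, (j * M + i) / (M : ℤ) = j := by
    intro j i hi
    have hi' : i < M := Finset.mem_range.1 hi
    rw [add_comm, Int.add_mul_ediv_right _ _ hMz.ne', Int.ediv_eq_zero_of_lt (by positivity)
      (by exact_mod_cast hi'), zero_add]
  have hinj : Set.InjOn g (S ×ˢ Finset.range M : Finset (ℤ × ℕ)) := by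
    rintro ⟨j, i⟩ hp ⟨j', i'⟩ hp' heq
    have h1 := (Finset.mem_product.1 hp).2
    have h2 := (Finset.mem_product.1 hp').2
    simp only [hg] at heq h1 h2
    have hj : j = j' := by rw [← hdiv j i h1, heq, hdiv j' i' h2]
    subst hj
    have : i = i' := by exact_mod_cast add_left_cancel heq
    rw [this]
  refine ⟨(S ×ˢ Finset.range M).image g, ?_, ?_⟩
  · ext x
    rw [mem_gridSet (Nat.mul_pos hN hM), mem_gridSet hN, Finset.mem_image]
    have hfl : ⌊x * N⌋ = ⌊x * (N * M : ℕ)⌋ / (M : ℤ) := by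
      rw [Nat.cast_mul, ← mul_assoc, ← Int.floor_div_natCast, mul_div_cancel_right₀ _ hM'.ne']
    rw [hfl]
    set m := ⌊x * (N * M : ℕ)⌋
    constructor
    · rintro ⟨⟨j, i⟩, hp, heq⟩
      obtain ⟨h1, h2⟩ := Finset.mem_product.1 hp
      simp only [hg] at heq h1 h2
      rw [← heq, hdiv j i h2]
      exact h1
    · intro hm
      refine ⟨(m / M, (m % M).toNat), Finset.mem_product.2 ⟨hm, ?_⟩, ?_⟩
      · rw [Finset.mem_range]
        have := Int.emod_lt_of_pos m hMz
        have := Int.emod_nonneg m hMz.ne'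
        omega
      · simp only [hg]
        rw [Int.toNat_of_nonneg (Int.emod_nonneg m hMz.ne')]
        exact Int.ediv_mul_add_emod m M
  · ext t
    unfold gridLog logRatioSum
    rw [Finset.sum_image hinj, Finset.sum_product]
    refine Finset.sum_congr rfl fun j _ => ?_
    have := Finset.sum_range_sub (fun i : ℕ => Real.log (((j : ℝ) * M + i) / (N * M) - t)) M
    simp only [hg]
    push_cast at this ⊢
    rw [show ((j : ℝ) * M + M) / (N * M) = (j + 1) / N by field_simp,
      show ((j : ℝ) * M + 0) / (N * M) = j / N by field_simp; ring] at this
    rw [← this]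
    refine Finset.sum_congr rfl fun i _ => ?_
    ring_nf

theorem gridSet_sdiff (hN : 0 < N) (S S' : Finset ℤ) :
    gridSet N (S \ S') = gridSet N S \ gridSet N S' := by
  ext x
  simp only [Set.mem_sdiff, mem_gridSet hN, Finset.mem_sdiff]

theorem lintegral_gridLog_le (hN : 0 < N) (S : Finset ℤ) {C : ℝ} (hC : 0 < C)
    (h : volume (gridSet N S) ≤ ENNReal.ofReal (C ^ 2)) :
    ∫⁻ x in Ioo (-1 : ℝ) 1, ENNReal.ofReal |gridLog N S x| ≤ ENNReal.ofReal (10 * C) := by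
  rw [volume_gridSet hN, ENNReal.ofReal_le_ofReal_iff (by positivity)] at h
  exact (separatedIntervals_grid hN S).lintegral_abs_logRatioSum_le hC h

theorem lintegral_gridLog_sub_gridLog_le {M : ℕ} (hN : 0 < N) (hM : 0 < M) (S S' : Finset ℤ)
    {C : ℝ} (hC : 0 < C)
    (h : volume (symmDiff (gridSet N S) (gridSet M S')) ≤ ENNReal.ofReal (C ^ 2)) :
    ∫⁻ x in Ioo (-1 : ℝ) 1, ENNReal.ofReal |gridLog N S x - gridLog M S' x| ≤
      ENNReal.ofReal (20 * C) := by
  obtain ⟨T, hT, hT'⟩ := exists_gridSet_refine hN hM S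
  obtain ⟨T', hU, hU'⟩ := exists_gridSet_refine hM hN S'
  rw [mul_comm] at hU hU'
  have hNM : 0 < N * M := Nat.mul_pos hN hM
  rw [← hT, ← hU, Set.symmDiff_def] at h
  rw [← hT', ← hU']
  have h1 := lintegral_gridLog_le hNM (T \ T') hC (by
    rw [gridSet_sdiff hNM]; exact (measure_mono subset_union_left).trans h)
  have h2 := lintegral_gridLog_le hNM (T' \ T) hC (by
    rw [gridSet_sdiff hNM]; exact (measure_mono subset_union_right).trans h)
  have heq : ∀ x, gridLog (N * M) T x - gridLog (N * M) T' x =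
      gridLog (N * M) (T \ T') x - gridLog (N * M) (T' \ T) x := by
    intro x
    exact Finset.sum_sdiff_sub_sum_sdiff.symm
  calc ∫⁻ x in Ioo (-1 : ℝ) 1, ENNReal.ofReal |gridLog (N * M) T x - gridLog (N * M) T' x|
      ≤ ∫⁻ x in Ioo (-1 : ℝ) 1, (ENNReal.ofReal |gridLog (N * M) (T \ T') x| +
          ENNReal.ofReal |gridLog (N * M) (T' \ T) x|) := by
        refine lintegral_mono fun x => ?_
        simp only
        rw [heq, ← ENNReal.ofReal_add (abs_nonneg _) (abs_nonneg _)]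
        exact ENNReal.ofReal_le_ofReal (abs_sub _ _)
    _ = _ := lintegral_add_left (measurable_gridLog _ _).abs.ennreal_ofReal _
    _ ≤ _ := add_le_add h1 h2
    _ = _ := by
        rw [← ENNReal.ofReal_add (by positivity) (by positivity)]
        ring_nf

/-- Borel subsets of `(-1, 1)` are approximated in measure by grid sets inside `(-1, 1)`. -/
theorem exists_gridSet_symmDiff_le {A : Set ℝ} (hA : MeasurableSet A) (hsub : A ⊆ Ioo (-1) 1)
    {ε : ENNReal} (hε : ε ≠ 0) :
    ∃ N : ℕ, 0 < N ∧ ∃ S : Finset ℤ, gridSet N S ⊆ Ioo (-1) 1 ∧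
      volume (symmDiff (gridSet N S) A) ≤ ε := by
  have hε2 : ε / 2 ≠ 0 := by simpa using hε
  have hAfin : volume A ≠ ⊤ := ((measure_mono hsub).trans_lt measure_Ioo_lt_top).ne
  obtain ⟨K, hKA, hKc, hK⟩ := hA.exists_isCompact_sdiff_lt hAfin hε2
  obtain ⟨U₀, hKU₀, hU₀o, -, hU₀⟩ := hKc.measurableSet.exists_isOpen_sdiff_lt
    (hKc.measure_ne_top (μ := volume)) hε2
  set U := U₀ ∩ Ioo (-1) 1 with hUdef
  have hUo : IsOpen U := hU₀o.inter isOpen_Ioo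
  have hKU : K ⊆ U := subset_inter hKU₀ (hKA.trans hsub)
  obtain ⟨d, hd, hdU⟩ := hKc.exists_thickening_subset_open hUo hKU
  obtain ⟨n, hn⟩ := exists_nat_one_div_lt hd
  set N := n + 1 with hNdef
  have hN : 0 < N := Nat.succ_pos n
  have hN' : (0 : ℝ) < N := by exact_mod_cast hN
  set S : Finset ℤ := (Finset.Icc (-(N : ℤ)) N).filter
    fun k => (Ico ((k : ℝ) / N) (((k : ℝ) + 1) / N) ∩ K).Nonempty with hS
  have hEU : gridSet N S ⊆ U := by
    intro x hx
    simp only [gridSet, mem_iUnion, exists_prop] at hx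
    obtain ⟨k, hk, hxk⟩ := hx
    obtain ⟨z, hz, hzK⟩ := (Finset.mem_filter.1 hk).2
    refine hdU (Metric.mem_thickening_iff.2 ⟨z, hzK, ?_⟩)
    refine lt_of_le_of_lt ?_ hn
    have hlen : ((k : ℝ) + 1) / N - k / N = 1 / ((n : ℝ) + 1) := by
      rw [hNdef]; push_cast; ring
    rw [Real.dist_eq, abs_le]
    constructor <;> linarith [hxk.1, hxk.2, hz.1, hz.2]
  have hKE : K ⊆ gridSet N S := by
    intro z hz
    have hz1 := hsub (hKA hz)
    rw [mem_gridSet hN, hS, Finset.mem_filter, Finset.mem_Icc]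
    refine ⟨⟨?_, ?_⟩, z, ⟨?_, ?_⟩, hz⟩
    · rw [Int.le_floor]
      push_cast
      nlinarith [hz1.1]
    · refine (Int.floor_le_iff.2 ?_)
      push_cast
      nlinarith [hz1.2]
    · rw [div_le_iff₀ hN']; exact Int.floor_le _
    · rw [lt_div_iff₀ hN']; exact Int.lt_floor_add_one _
  refine ⟨N, hN, S, hEU.trans inter_subset_right, ?_⟩
  calc volume (symmDiff (gridSet N S) A) ≤ volume ((U₀ \ K) ∪ (A \ K)) := by
        refine measure_mono ?_
        rintro x (⟨h1, h2⟩ | ⟨h1, h2⟩)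
        · exact Or.inl ⟨(hEU h1).1, fun h => h2 (hKA h)⟩
        · exact Or.inr ⟨h1, fun h => h2 (hKE h)⟩
    _ ≤ ε / 2 + ε / 2 := (measure_union_le _ _).trans (add_le_add hU₀.le hK.le)
    _ = ε := ENNReal.add_halves ε

end Grid

section Limit

theorem memLp_gridLog {N : ℕ} (hN : 0 < N) (S : Finset ℤ) :
    MemLp (gridLog N S) 1 (volume.restrict (Ioo (-1 : ℝ) 1)) := by
  refine ⟨(measurable_gridLog N S).aestronglyMeasurable, ?_⟩
  rw [eLpNorm_one_eq_lintegral_enorm]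
  have hfin : volume (gridSet N S) ≠ ⊤ := by
    rw [volume_gridSet hN]; exact ENNReal.ofReal_ne_top
  have h := lintegral_gridLog_le hN S (C := (volume (gridSet N S)).toReal + 1) (by positivity) (by
    rw [← ENNReal.ofReal_toReal hfin]
    refine ENNReal.ofReal_le_ofReal ?_
    rw [ENNReal.toReal_ofReal ENNReal.toReal_nonneg]
    nlinarith [ENNReal.toReal_nonneg (a := volume (gridSet N S))])
  simp only [← ofReal_norm, Real.norm_eq_abs]
  exact h.trans_lt ENNReal.ofReal_lt_top

/-- Grid sets approximating `A` have logarithmic potentials converging in `L¹(-1,1)`; the limit is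
`π` times the Hilbert transform of the indicator of `A`. -/
theorem exists_limit_gridLog {A : Set ℝ} (hA : MeasurableSet A) (hsub : A ⊆ Ioo (-1) 1) :
    ∃ g : ℝ → ℝ, Measurable g ∧ Integrable g ∧
      (∀ x h, 0 < h → -1 ≤ x - h → x + h ≤ 1 →
        ∫ t in (x - h)..(x + h), g t = ∫ s in A, logKernel h (s - x)) ∧
      ENNReal.ofReal (2 / (Real.exp Real.pi + 1)) * volume A ≤
        volume {x | x ∈ A ∧ Real.pi ≤ |g x|} := by
  set μ : Measure ℝ := volume.restrict (Ioo (-1 : ℝ) 1) with hμ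
  have happ : ∀ k : ℕ, ∃ N : ℕ, 0 < N ∧ ∃ S : Finset ℤ, gridSet N S ⊆ Ioo (-1) 1 ∧
      volume (symmDiff (gridSet N S) A) ≤ ENNReal.ofReal (((1 / 2 : ℝ) ^ k) ^ 2 / 2) := by
    intro k
    refine exists_gridSet_symmDiff_le hA hsub ?_
    rw [Ne, ENNReal.ofReal_eq_zero, not_le]
    positivity
  choose N hN S hSsub hSA using happ
  set E : ℕ → Set ℝ := fun k => gridSet (N k) (S k) with hE
  set f : ℕ → ℝ → ℝ := fun k => gridLog (N k) (S k) with hf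
  have hfLp : ∀ k, MemLp (f k) 1 μ := fun k => memLp_gridLog (hN k) (S k)
  have hcauchy : ∀ k n m : ℕ, k ≤ n → k ≤ m →
      eLpNorm (f n - f m) 1 μ < ENNReal.ofReal (21 * (1 / 2 : ℝ) ^ k) := by
    intro k n m hkn hkm
    have hpow : ∀ n, k ≤ n → volume (symmDiff (E n) A) ≤
        ENNReal.ofReal (((1 / 2 : ℝ) ^ k) ^ 2 / 2) := by
      intro n hkn
      refine (hSA n).trans (ENNReal.ofReal_le_ofReal ?_)
      have : (1 / 2 : ℝ) ^ n ≤ (1 / 2) ^ k := pow_le_pow_of_le_one (by norm_num) (by norm_num) hkn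
      gcongr
    have hsd : volume (symmDiff (E n) (E m)) ≤ ENNReal.ofReal (((1 / 2 : ℝ) ^ k) ^ 2) := by
      refine (measure_symmDiff_le (E n) A (E m)).trans ?_
      rw [symmDiff_comm A]
      refine (add_le_add (hpow n hkn) (hpow m hkm)).trans ?_
      rw [← ENNReal.ofReal_add (by positivity) (by positivity), add_halves]
    have h := lintegral_gridLog_sub_gridLog_le (hN n) (hN m) (S n) (S m)
      (C := (1 / 2 : ℝ) ^ k) (by positivity) hsd
    rw [eLpNorm_one_eq_lintegral_enorm]
    simp only [← ofReal_norm, Real.norm_eq_abs, Pi.sub_apply]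
    refine h.trans_lt ((ENNReal.ofReal_lt_ofReal_iff (by positivity)).2 ?_)
    have : (0 : ℝ) < (1 / 2 : ℝ) ^ k := by positivity
    linarith
  have hB : ∑' k : ℕ, ENNReal.ofReal (21 * (1 / 2 : ℝ) ^ k) ≠ ⊤ := by
    rw [← ENNReal.ofReal_tsum_of_nonneg (fun k => by positivity)
      (summable_geometric_two.mul_left 21)]
    exact ENNReal.ofReal_ne_top
  obtain ⟨g₀, hg₀, hlim₀⟩ := Lp.cauchy_complete_eLpNorm le_rfl hfLp hB hcauchy
  set g : ℝ → ℝ := (Ioo (-1 : ℝ) 1).indicator (hg₀.1.mk g₀) with hg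
  have hgg₀ : g =ᵐ[μ] g₀ := by
    refine (indicator_ae_eq_restrict measurableSet_Ioo).trans hg₀.1.ae_eq_mk.symm
  have hgm : Measurable g := hg₀.1.stronglyMeasurable_mk.measurable.indicator measurableSet_Ioo
  have hgint : Integrable g := by
    rw [hg, integrable_indicator_iff measurableSet_Ioo]
    exact (memLp_one_iff_integrable.1 hg₀).congr hg₀.1.ae_eq_mk
  have hlim : Tendsto (fun n => eLpNorm (f n - g) 1 μ) atTop (nhds 0) := by
    refine hlim₀.congr fun n => eLpNorm_congr_ae ?_
    exact (EventuallyEq.refl _ (f n)).sub hgg₀.symm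
  have hEA : ∀ᵐ x, ∀ᶠ k in atTop, (x ∈ E k ↔ x ∈ A) := by
    have hsum : ∑' k, volume (symmDiff (E k) A) ≠ ⊤ := by
      refine ne_top_of_le_ne_top hB (ENNReal.tsum_le_tsum fun k => (hSA k).trans ?_)
      refine ENNReal.ofReal_le_ofReal ?_
      have h1 : (0 : ℝ) < (1 / 2 : ℝ) ^ k := by positivity
      have h2 : (1 / 2 : ℝ) ^ k ≤ 1 := pow_le_one₀ (by norm_num) (by norm_num)
      nlinarith
    filter_upwards [ae_eventually_notMem hsum] with x hx
    filter_upwards [hx] with k hk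
    rw [Set.mem_symmDiff] at hk
    tauto
  refine ⟨g, hgm, hgint, ?_, ?_⟩
  · intro x h hh h1 h2
    have hIsub : Ioo (x - h) (x + h) ⊆ Ioo (-1 : ℝ) 1 := Ioo_subset_Ioo h1 h2
    have hconv : ∀ u : ℝ → ℝ, ∫ t in (x - h)..(x + h), u t =
        ∫ t in Ioo (x - h) (x + h), u t ∂μ := by
      intro u
      rw [intervalIntegral.integral_of_le (by linarith), integral_Ioc_eq_integral_Ioo, hμ,
        Measure.restrict_restrict measurableSet_Ioo, inter_eq_left.2 hIsub]
    have hl : Tendsto (fun n => ∫ t in (x - h)..(x + h), f n t) atTop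
        (nhds (∫ t in (x - h)..(x + h), g t)) := by
      simp only [hconv]
      refine tendsto_setIntegral_of_L1 g hgm.aestronglyMeasurable
        (Eventually.of_forall fun n => memLp_one_iff_integrable.1 (hfLp n)) ?_ _
      simpa only [eLpNorm_one_eq_lintegral_enorm, Pi.sub_apply] using hlim
    have hr : Tendsto (fun n => ∫ s in E n, logKernel h (s - x)) atTop
        (nhds (∫ s in A, logKernel h (s - x))) := by
      have hK : IntegrableOn (fun s => logKernel h (s - x)) (Ioo (-1) 1) := by
        have := intervalIntegrable_logKernel h x (-1) 1
        rw [intervalIntegrable_iff_integrableOn_Ioc_of_le (by norm_num)] at this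
        exact this.mono_set Ioo_subset_Ioc_self
      have hrw : ∀ B : Set ℝ, MeasurableSet B → B ⊆ Ioo (-1) 1 →
          ∫ s in B, logKernel h (s - x) = ∫ s, B.indicator (fun s => logKernel h (s - x)) s ∂μ := by
        intro B hB hBs
        rw [integral_indicator hB, hμ, Measure.restrict_restrict hB, inter_eq_left.2 hBs]
      rw [hrw A hA hsub]
      simp only [fun n => hrw (E n) (measurableSet_gridSet _ _) (hSsub n)]
      refine tendsto_integral_of_dominated_convergence (fun s => ‖logKernel h (s - x)‖)
        (fun n => hK.1.indicator (measurableSet_gridSet _ _)) hK.norm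
        (fun n => Eventually.of_forall fun s => norm_indicator_le_norm_self _ _) ?_
      filter_upwards [ae_restrict_of_ae hEA] with s hs
      refine tendsto_const_nhds.congr' ?_
      filter_upwards [hs] with n hn
      by_cases hsA : s ∈ A
      · rw [indicator_of_mem hsA, indicator_of_mem (hn.2 hsA)]
      · rw [indicator_of_notMem hsA, indicator_of_notMem fun h => hsA (hn.1 h)]
    refine tendsto_nhds_unique hl (hr.congr fun n => ?_)
    exact (integral_gridLog (hN n) (S n) x h).symm
  · obtain ⟨ns, hns, hae⟩ := (tendstoInMeasure_of_tendsto_eLpNorm one_ne_zero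
      (fun n => (hfLp n).1) hgm.aestronglyMeasurable hlim).exists_seq_tendsto_ae
    set δ : ENNReal := ENNReal.ofReal (2 / (Real.exp Real.pi + 1)) with hδ
    set G : ℕ → Set ℝ := fun i => {x | x ∈ E (ns i) ∧ Real.pi ≤ |f (ns i) x|} with hG
    set B : Set ℝ := {x | x ∈ A ∧ Real.pi ≤ |g x|} with hBdef
    have hGm : ∀ i, MeasurableSet (G i) := fun i =>
      (measurableSet_gridSet _ _).inter
        (measurableSet_le measurable_const (measurable_gridLog _ _).abs)
    have hBm : MeasurableSet B := hA.inter (measurableSet_le measurable_const hgm.abs)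
    have hμv : ∀ C : Set ℝ, MeasurableSet C → C ⊆ Ioo (-1) 1 → μ C = volume C := by
      intro C hC hCs
      rw [hμ, Measure.restrict_apply hC, inter_eq_left.2 hCs]
    have hEtend : Tendsto (fun i => δ * μ (E (ns i))) atTop (nhds (δ * μ A)) := by
      refine ENNReal.Tendsto.const_mul ?_ (Or.inr ENNReal.ofReal_ne_top)
      have : Tendsto (fun i => μ (E i)) atTop (nhds (μ A)) :=
        tendsto_measure_of_ae_tendsto_indicator_of_isFiniteMeasure atTop hA
          (fun i => measurableSet_gridSet _ _) (ae_restrict_of_ae hEA)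
      exact this.comp hns.tendsto_atTop
    have hle : ∀ i, δ * μ (E (ns i)) ≤ μ (G i) := by
      intro i
      rw [hμv _ (measurableSet_gridSet _ _) (hSsub _),
        hμv _ (hGm i) fun x hx => hSsub _ hx.1]
      exact le_volume_gridLog (hN _) (S _)
    have hfatou := limsup_lintegral_le (μ := μ) (f := fun i => (G i).indicator 1) (fun _ => 1)
      (fun i => measurable_one.indicator (hGm i))
      (fun i => Eventually.of_forall fun x => indicator_le_self' (fun _ _ => zero_le_one) x)
      (by simp [hμ])
    rw [← hμv A hA hsub, ← hμv B hBm fun x hx => hsub hx.1, ← hEtend.limsup_eq]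
    refine (limsup_le_limsup (Eventually.of_forall hle)).trans ?_
    simp only [lintegral_indicator_one (hGm _)] at hfatou
    refine hfatou.trans ?_
    rw [← lintegral_indicator_one hBm]
    refine lintegral_mono_ae ?_
    filter_upwards [hae, ae_restrict_of_ae hEA] with x hx hxE
    by_cases hxB : x ∈ B
    · rw [indicator_of_mem hxB]
      refine limsup_le_of_le (h := Eventually.of_forall fun i => ?_)
      exact indicator_le_self' (fun _ _ => zero_le_one) x
    · have hev : ∀ᶠ i in atTop, x ∉ G i := by
        by_contra hfreq
        rw [not_eventually] at hfreq
        simp only [not_not] at hfreq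
        refine hxB ⟨?_, ?_⟩
        · obtain ⟨i, hi, hi'⟩ := (hfreq.and_eventually (hns.tendsto_atTop.eventually hxE)).exists
          exact hi'.1 hi.1
        · exact ge_of_tendsto_of_frequently hx.abs (hfreq.mono fun i hi => hi.2)
      have : Tendsto (fun i => (G i).indicator (1 : ℝ → ENNReal) x) atTop (nhds 0) := by
        refine tendsto_const_nhds.congr' ?_
        filter_upwards [hev] with i hi
        rw [indicator_of_notMem hi]
      rw [this.limsup_eq]
      exact zero_le

end Limit

section Truncation

/-- The truncated Hilbert kernel `1 / u` on `h < |u|`. -/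
noncomputable def truncKernel (h u : ℝ) : ℝ := if h < |u| then u⁻¹ else 0

theorem measurable_truncKernel (h : ℝ) : Measurable (truncKernel h) :=
  Measurable.ite (measurableSet_lt measurable_const measurable_id.abs) measurable_inv
    measurable_const

theorem abs_truncKernel_le {h : ℝ} (hh : 0 < h) (u : ℝ) : |truncKernel h u| ≤ h⁻¹ := by
  unfold truncKernel
  split_ifs with hu
  · rw [abs_inv]
    exact inv_anti₀ hh hu.le
  · simpa using hh.le

/-- The difference between the averaged and the truncated Hilbert kernels at unit scale. -/
noncomputable def kernelGap (u : ℝ) : ℝ := 2⁻¹ * logKernel 1 u - truncKernel 1 u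

theorem kernelGap_neg (u : ℝ) : kernelGap (-u) = -kernelGap u := by
  unfold kernelGap logKernel truncKernel
  rw [← Real.log_neg_eq_log (-u + 1), ← Real.log_neg_eq_log (-u - 1), abs_neg, inv_neg,
    show -(-u + 1) = u - 1 by ring, show -(-u - 1) = u + 1 by ring]
  split_ifs <;> ring

theorem measurable_kernelGap : Measurable kernelGap := by
  unfold kernelGap logKernel
  have := measurable_truncKernel 1
  fun_prop

theorem abs_kernelGap_le {u : ℝ} (hu : 2 ≤ |u|) : |kernelGap u| ≤ 4 * (1 + u ^ 2)⁻¹ := by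
  have hu0 : u ≠ 0 := by rintro rfl; norm_num at hu
  have hv : |u⁻¹| ≤ 2⁻¹ := by rw [abs_inv]; exact inv_anti₀ (by norm_num) hu
  have hbound : ∀ v : ℝ, |v| ≤ 2⁻¹ → |v + Real.log (1 - v)| ≤ 2 * v ^ 2 := by
    intro v hv
    have h := Real.abs_log_sub_add_sum_range_le (x := v) (by linarith) 1
    simp only [Finset.sum_range_one, zero_add, pow_one, Nat.cast_zero, div_one, sq_abs,
      Nat.reduceAdd] at h
    refine h.trans ?_
    rw [div_le_iff₀ (by linarith)]
    nlinarith [sq_nonneg v]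
  have h1 := hbound u⁻¹ hv
  have h2 := hbound (-u⁻¹) (by rwa [abs_neg])
  have hne1 : 1 - u⁻¹ ≠ 0 := (by linarith [le_abs_self u⁻¹] : 0 < 1 - u⁻¹).ne'
  have hne2 : 1 - -u⁻¹ ≠ 0 := (by linarith [neg_abs_le u⁻¹] : 0 < 1 - -u⁻¹).ne'
  have hlog : logKernel 1 u = Real.log (1 - -u⁻¹) - Real.log (1 - u⁻¹) := by
    unfold logKernel
    rw [show u + 1 = u * (1 - -u⁻¹) by field_simp; ring, show u - 1 = u * (1 - u⁻¹) by field_simp,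
      Real.log_mul hu0 hne2, Real.log_mul hu0 hne1]
    ring
  have hgap : |kernelGap u| ≤ 2 * (u⁻¹) ^ 2 := by
    unfold kernelGap truncKernel
    rw [if_pos (by linarith), hlog]
    rw [neg_sq] at h2
    rw [abs_le] at h1 h2 ⊢
    constructor <;> linarith [h1.1, h1.2, h2.1, h2.2]
  refine hgap.trans ?_
  have hsq : 4 ≤ u ^ 2 := by rw [← sq_abs]; nlinarith
  rw [inv_pow, ← div_eq_mul_inv, ← div_eq_mul_inv, div_le_div_iff₀ (by linarith) (by linarith)]
  linarith

theorem integrable_kernelGap : Integrable kernelGap := by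
  rw [← integrableOn_univ, ← union_compl_self (Icc (-2 : ℝ) 2)]
  refine IntegrableOn.union ?_ ?_
  · rw [integrableOn_Icc_iff_integrableOn_Ioc]
    unfold kernelGap
    refine Integrable.sub ?_ ?_
    · have h := intervalIntegrable_logKernel 1 0 (-2) 2
      rw [intervalIntegrable_iff_integrableOn_Ioc_of_le (by norm_num)] at h
      simp only [sub_zero] at h
      exact h.const_mul _
    · refine Measure.integrableOn_of_bounded (M := 1) (by simp)
        (measurable_truncKernel 1).aestronglyMeasurable (Eventually.of_forall fun u => ?_)
      simpa using abs_truncKernel_le one_pos u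
  · refine Integrable.mono' (integrable_inv_one_add_sq.integrableOn.const_mul 4)
      measurable_kernelGap.aestronglyMeasurable ?_
    refine (ae_restrict_iff' measurableSet_Icc.compl).2 (Eventually.of_forall fun u hu => ?_)
    refine abs_kernelGap_le ?_
    by_contra h
    exact hu (mem_Icc.2 (abs_le.1 (not_le.1 h).le))

theorem integral_kernelGap : ∫ u, kernelGap u = 0 := by
  have h := integral_neg_eq_self kernelGap volume
  simp only [kernelGap_neg, integral_neg] at h
  linarith

theorem tendsto_setIntegral_zero_of_locally {ι : Type*} {l : Filter ι} {f : ℝ → ℝ}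
    (hf : Integrable f) {B : ι → Set ℝ}
    (hB : ∀ M : ℕ, Tendsto (fun i => volume (B i ∩ Icc (-(M : ℝ)) M)) l (nhds 0)) :
    Tendsto (fun i => ∫ u in B i, f u) l (nhds 0) := by
  rw [tendsto_zero_iff_enorm_tendsto_zero]
  have htail : Tendsto (fun M : ℕ => ∫⁻ u in (Icc (-(M : ℝ)) M)ᶜ, ‖f u‖ₑ) atTop (nhds 0) := by
    have hfin : volume.withDensity (fun u => ‖f u‖ₑ) (Icc (-((0 : ℕ) : ℝ)) (0 : ℕ))ᶜ ≠ ⊤ := by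
      rw [withDensity_apply _ measurableSet_Icc.compl]
      exact ((setLIntegral_le_lintegral _ _).trans_lt hf.2).ne
    have h := tendsto_measure_iInter_atTop
      (μ := volume.withDensity (fun u => ‖f u‖ₑ)) (s := fun M : ℕ => (Icc (-(M : ℝ)) M)ᶜ)
      (fun M => measurableSet_Icc.compl.nullMeasurableSet)
      (fun m n hmn => compl_subset_compl.2 (Icc_subset_Icc
        (neg_le_neg (by exact_mod_cast hmn)) (by exact_mod_cast hmn))) ⟨0, hfin⟩
    have hempty : ⋂ M : ℕ, (Icc (-(M : ℝ)) M)ᶜ = ∅ := by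
      refine eq_empty_of_forall_notMem fun x hx => ?_
      obtain ⟨M, hM⟩ := exists_nat_ge |x|
      exact (mem_iInter.1 hx M) (mem_Icc.2 (abs_le.1 hM))
    rw [hempty, measure_empty] at h
    refine h.congr fun M => ?_
    rw [Function.comp_apply, withDensity_apply _ measurableSet_Icc.compl]
  rw [ENNReal.tendsto_nhds_zero]
  intro ε hε
  have hε2 : 0 < ε / 2 := ENNReal.half_pos hε.ne'
  obtain ⟨M, hM⟩ := ((ENNReal.tendsto_nhds_zero.1 htail) (ε / 2) hε2).exists
  have hnear := tendsto_setLIntegral_zero (f := fun u => ‖f u‖ₑ) hf.2.ne (hB M)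
  filter_upwards [(ENNReal.tendsto_nhds_zero.1 hnear) (ε / 2) hε2] with i hi
  calc ‖∫ u in B i, f u‖ₑ ≤ ∫⁻ u in B i, ‖f u‖ₑ := enorm_integral_le_lintegral_enorm _
    _ ≤ ∫⁻ u in (B i ∩ Icc (-(M : ℝ)) M) ∪ (Icc (-(M : ℝ)) M)ᶜ, ‖f u‖ₑ := by
        refine lintegral_mono_set fun u hu => ?_
        by_cases h : u ∈ Icc (-(M : ℝ)) M
        · exact Or.inl ⟨hu, h⟩
        · exact Or.inr h
    _ ≤ _ := lintegral_union_le _ _ _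
    _ ≤ ε / 2 + ε / 2 := add_le_add hi hM
    _ = ε := ENNReal.add_halves ε

theorem tendsto_setIntegral_kernelGap {A : Set ℝ} (hA : MeasurableSet A) {x : ℝ}
    (hx : Tendsto (fun r => volume (Aᶜ ∩ Metric.closedBall x r) / volume (Metric.closedBall x r))
      (nhdsWithin 0 (Ioi 0)) (nhds 0)) :
    Tendsto (fun h : ℝ => ∫ u in (fun u => x + h * u) ⁻¹' A, kernelGap u)
      (nhdsWithin 0 (Ioi 0)) (nhds 0) := by
  have hmeas : ∀ h : ℝ, MeasurableSet ((fun u => x + h * u) ⁻¹' A) := fun h =>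
    (by fun_prop : Measurable fun u => x + h * u) hA
  have hcompl : ∀ h : ℝ, ∫ u in (fun u => x + h * u) ⁻¹' A, kernelGap u =
      - ∫ u in ((fun u => x + h * u) ⁻¹' A)ᶜ, kernelGap u := by
    intro h
    have := integral_add_compl (hmeas h) integrable_kernelGap
    rw [integral_kernelGap] at this
    linarith
  simp only [hcompl]
  suffices hloc : ∀ M : ℕ, Tendsto (fun h : ℝ => volume
      (((fun u => x + h * u) ⁻¹' A)ᶜ ∩ Icc (-(M : ℝ)) M)) (nhdsWithin 0 (Ioi 0)) (nhds 0) by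
    simpa using (tendsto_setIntegral_zero_of_locally integrable_kernelGap hloc).neg
  intro M
  rcases Nat.eq_zero_or_pos M with rfl | hM
  · have : ∀ i : ℝ, volume (((fun u => x + i * u) ⁻¹' A)ᶜ ∩ Icc (-((0 : ℕ) : ℝ)) (0 : ℕ)) = 0 := by
      intro i
      refine measure_mono_null inter_subset_right ?_
      simp
    simp only [this]
    exact tendsto_const_nhds
  have hM' : (0 : ℝ) < M := by exact_mod_cast hM
  have hscale : Tendsto (fun h : ℝ => h * M) (nhdsWithin 0 (Ioi 0)) (nhdsWithin 0 (Ioi 0)) := by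
    refine tendsto_nhdsWithin_iff.2 ⟨?_, ?_⟩
    · have : Tendsto (fun h : ℝ => h * M) (nhds 0) (nhds (0 * M)) :=
        (continuous_id.mul continuous_const).tendsto _
      rw [zero_mul] at this
      exact this.mono_left nhdsWithin_le_nhds
    · filter_upwards [self_mem_nhdsWithin] with h hh
      exact mul_pos hh hM'
  have hlim := ENNReal.Tendsto.const_mul (a := ENNReal.ofReal (2 * M)) (hx.comp hscale)
    (Or.inr ENNReal.ofReal_ne_top)
  rw [mul_zero] at hlim
  refine hlim.congr' ?_
  filter_upwards [self_mem_nhdsWithin] with h hh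
  have hh' : (0 : ℝ) < h := hh
  have hset : ((fun u => x + h * u) ⁻¹' A)ᶜ ∩ Icc (-(M : ℝ)) M =
      (fun u => h * u) ⁻¹' ((fun s => x + s) ⁻¹' (Aᶜ ∩ Metric.closedBall x (h * M))) := by
    ext u
    simp only [mem_inter_iff, mem_compl_iff, mem_preimage, Metric.mem_closedBall, Real.dist_eq,
      add_sub_cancel_left, mem_Icc, abs_mul, abs_of_pos hh', mul_le_mul_iff_right₀ hh', abs_le]
  rw [hset, Real.volume_preimage_mul_left hh'.ne', measure_preimage_add, Function.comp_apply,
    Real.volume_closedBall, abs_inv, abs_of_pos hh', ← mul_div_assoc, mul_comm,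
    mul_div_assoc, mul_comm, ← ENNReal.ofReal_div_of_pos (by positivity)]
  congr 2
  field_simp

theorem integral_truncKernel_eq {A : Set ℝ} (hA : MeasurableSet A) (hsub : A ⊆ Ioo (-1) 1)
    (x : ℝ) {h : ℝ} (hh : 0 < h) :
    ∫ s in A, truncKernel h (s - x) = (2 * h)⁻¹ * (∫ s in A, logKernel h (s - x)) -
      ∫ u in (fun u => x + h * u) ⁻¹' A, kernelGap u := by
  have hmeas : MeasurableSet ((fun u => x + h * u) ⁻¹' A) :=
    (by fun_prop : Measurable fun u => x + h * u) hA
  have hK : IntegrableOn (fun s => logKernel h (s - x)) A := by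
    have := intervalIntegrable_logKernel h x (-1) 1
    rw [intervalIntegrable_iff_integrableOn_Ioc_of_le (by norm_num)] at this
    exact this.mono_set (hsub.trans Ioo_subset_Ioc_self)
  have hT : IntegrableOn (fun s => truncKernel h (s - x)) A := by
    refine Measure.integrableOn_of_bounded (M := h⁻¹)
      ((measure_mono hsub).trans_lt measure_Ioo_lt_top).ne
      ((measurable_truncKernel h).comp (by fun_prop)).aestronglyMeasurable
      (Eventually.of_forall fun s => abs_truncKernel_le hh _)
  have hmain : ∫ u in (fun u => x + h * u) ⁻¹' A, kernelGap u =
      ∫ s in A, ((2 * h)⁻¹ * logKernel h (s - x) - truncKernel h (s - x)) := by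
    rw [← integral_indicator hA, ← integral_indicator hmeas]
    rw [← integral_add_left_eq_self (A.indicator fun s =>
      (2 * h)⁻¹ * logKernel h (s - x) - truncKernel h (s - x)) x]
    have := Measure.integral_comp_mul_left (fun s => A.indicator (fun s =>
      (2 * h)⁻¹ * logKernel h (s - x) - truncKernel h (s - x)) (x + s)) h
    rw [abs_of_pos (inv_pos.2 hh), smul_eq_mul, inv_mul_eq_div, eq_div_iff hh.ne'] at this
    rw [← this, ← integral_mul_const]
    refine integral_congr_ae ?_
    have h1 : ∀ᵐ u : ℝ, u ≠ 1 := by simp [ae_iff]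
    have h2 : ∀ᵐ u : ℝ, u ≠ -1 := by simp [ae_iff]
    filter_upwards [h1, h2] with u hu1 hu2
    by_cases huA : x + h * u ∈ A
    · rw [indicator_of_mem (show u ∈ (fun u => x + h * u) ⁻¹' A from huA), indicator_of_mem huA,
        add_sub_cancel_left]
      unfold kernelGap logKernel truncKernel
      have e1 : u - 1 ≠ 0 := sub_ne_zero.2 hu1
      have e2 : u + 1 ≠ 0 := fun h => hu2 (by linarith)
      rw [show h * u + h = h * (u + 1) by ring, show h * u - h = h * (u - 1) by ring,
        Real.log_mul hh.ne' e1, Real.log_mul hh.ne' e2, abs_mul, abs_of_pos hh]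
      have : h < h * |u| ↔ 1 < |u| := by
        constructor
        · intro h1; nlinarith
        · intro h1; nlinarith
      simp only [this]
      split_ifs
      · rw [mul_inv, mul_inv]; field_simp; ring
      · rw [mul_inv]; field_simp; ring
    · rw [indicator_of_notMem (show u ∉ (fun u => x + h * u) ⁻¹' A from huA),
        indicator_of_notMem huA, zero_mul]
  rw [hmain, integral_sub (hK.const_mul _) hT, integral_const_mul]
  ring

/-- At almost every point of `A` the truncated Hilbert integrals of the indicator of `A`
converge. -/
theorem ae_tendsto_integral_truncKernel {A : Set ℝ} (hA : MeasurableSet A) (hsub : A ⊆ Ioo (-1) 1)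
    {g : ℝ → ℝ} (hg : Integrable g)
    (hgA : ∀ x h, 0 < h → -1 ≤ x - h → x + h ≤ 1 →
        ∫ t in (x - h)..(x + h), g t = ∫ s in A, logKernel h (s - x)) :
    ∀ᵐ x, x ∈ A → Tendsto (fun h => ∫ s in A, truncKernel h (s - x))
      (nhdsWithin 0 (Ioi 0)) (nhds (g x)) := by
  have hdens := Besicovitch.ae_tendsto_measure_inter_div_of_measurableSet (volume : Measure ℝ)
    hA.compl
  have havg := IsUnifLocDoublingMeasure.ae_tendsto_average (volume : Measure ℝ)
    hg.locallyIntegrable 1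
  filter_upwards [hdens, havg] with x hx hxg hxA
  rw [indicator_of_notMem (by simpa using hxA)] at hx
  have h1 := tendsto_setIntegral_kernelGap hA hx
  have h2 := hxg (fun _ : ℝ => x) id tendsto_id (by
    filter_upwards [self_mem_nhdsWithin] with h hh
    have : (0 : ℝ) < h := hh
    simpa using this.le)
  have h3 := h2.sub h1
  rw [sub_zero] at h3
  refine h3.congr' ?_
  have hx1 := hsub hxA
  have hlt : (0 : ℝ) < min (x + 1) (1 - x) := lt_min (by linarith [hx1.1]) (by linarith [hx1.2])
  filter_upwards [Ioo_mem_nhdsGT hlt] with h hh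
  have hh1 := hh.2.trans_le (min_le_left _ _)
  have hh2 := hh.2.trans_le (min_le_right _ _)
  have hh0 : 0 < h := hh.1
  rw [integral_truncKernel_eq hA hsub x hh0, ← hgA x h hh0 (by linarith) (by linarith),
    setAverage_eq, id, Real.closedBall_eq_Icc, intervalIntegral.integral_of_le (by linarith),
    integral_Icc_eq_integral_Ioc, Real.volume_real_Icc_of_le (by linarith), smul_eq_mul]
  congr 3
  ring

end Truncation

section HilbertTransform

theorem integral_div_sub_eq_integral_truncKernel {A : Set ℝ} (hA : MeasurableSet A)
    (hsub : A ⊆ Ioo (-1) 1) {x ε : ℝ} (hε : 0 < ε) (hx1 : -1 ≤ x - ε) (hx2 : x + ε ≤ 1) :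
    (∫ s in (-1 : ℝ)..(x - ε), A.indicator (fun _ => (1 : ℂ)) s / ((s : ℂ) - (x : ℂ))) +
      (∫ s in (x + ε)..(1 : ℝ), A.indicator (fun _ => (1 : ℂ)) s / ((s : ℂ) - (x : ℂ))) =
    ((∫ s in A, truncKernel ε (s - x) : ℝ) : ℂ) := by
  set F : ℝ → ℝ := A.indicator fun s => truncKernel ε (s - x) with hF
  have hT : IntegrableOn (fun s => truncKernel ε (s - x)) A := by
    refine Measure.integrableOn_of_bounded (M := ε⁻¹)
      ((measure_mono hsub).trans_lt measure_Ioo_lt_top).ne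
      ((measurable_truncKernel ε).comp (by fun_prop)).aestronglyMeasurable
      (Eventually.of_forall fun s => abs_truncKernel_le hε _)
  have hFint : Integrable F := hT.integrable_indicator hA
  have hne : ∀ᵐ s : ℝ, s ≠ x - ε := by simp [ae_iff]
  have hpoint : ∀ s, ε < |s - x| →
      A.indicator (fun _ => (1 : ℂ)) s / ((s : ℂ) - (x : ℂ)) = ((F s : ℝ) : ℂ) := by
    intro s hs
    by_cases hsA : s ∈ A
    · simp [hF, hsA, truncKernel, hs]
    · simp [hF, hsA]
  have hleft : (∫ s in (-1 : ℝ)..(x - ε), A.indicator (fun _ => (1 : ℂ)) s / ((s : ℂ) - (x : ℂ))) =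
      ((∫ s in (-1 : ℝ)..(x - ε), F s : ℝ) : ℂ) := by
    rw [← intervalIntegral.integral_ofReal]
    refine intervalIntegral.integral_congr_ae ?_
    filter_upwards [hne] with s hs hmem
    rw [uIoc_of_le hx1] at hmem
    have hlt := lt_of_le_of_ne hmem.2 hs
    exact hpoint s (by rw [lt_abs]; right; linarith)
  have hright : (∫ s in (x + ε)..(1 : ℝ), A.indicator (fun _ => (1 : ℂ)) s / ((s : ℂ) - (x : ℂ))) =
      ((∫ s in (x + ε)..(1 : ℝ), F s : ℝ) : ℂ) := by
    rw [← intervalIntegral.integral_ofReal]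
    refine intervalIntegral.integral_congr_ae (Eventually.of_forall fun s hmem => ?_)
    rw [uIoc_of_le hx2] at hmem
    exact hpoint s (by rw [lt_abs]; left; linarith [hmem.1])
  have hmid : ∫ s in (x - ε)..(x + ε), F s = 0 := by
    refine intervalIntegral.integral_zero_ae (Eventually.of_forall fun s hmem => ?_)
    rw [uIoc_of_le (by linarith)] at hmem
    have : ¬ ε < |s - x| := not_lt.2 (abs_le.2 ⟨by linarith [hmem.1], by linarith [hmem.2]⟩)
    simp [hF, truncKernel, this]
  have hall : ∫ s in A, truncKernel ε (s - x) = ∫ s in (-1 : ℝ)..1, F s := by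
    rw [intervalIntegral.integral_of_le (by norm_num), setIntegral_indicator hA,
      inter_eq_self_of_subset_right (hsub.trans Ioo_subset_Ioc_self)]
  have hii : ∀ a b : ℝ, IntervalIntegrable F volume a b := fun a b => hFint.intervalIntegrable
  rw [hleft, hright, hall, ← intervalIntegral.integral_add_adjacent_intervals (hii (-1) (x - ε))
    (hii (x - ε) 1), ← intervalIntegral.integral_add_adjacent_intervals (hii (x - ε) (x + ε))
    (hii (x + ε) 1), hmid, zero_add]
  push_cast
  rfl

theorem finiteHilbertT_eq_of_tendsto {A : Set ℝ} (hA : MeasurableSet A) (hsub : A ⊆ Ioo (-1) 1)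
    {x y : ℝ} (hxA : x ∈ A) (hy : Tendsto (fun h => ∫ s in A, truncKernel h (s - x))
      (nhdsWithin 0 (Ioi 0)) (nhds y)) :
    finiteHilbertT (A.indicator fun _ => (1 : ℂ)) x = ((y / Real.pi : ℝ) : ℂ) := by
  have hlim : Tendsto (fun ε : ℝ => (Real.pi : ℂ)⁻¹ *
      ((∫ s in (-1 : ℝ)..(x - ε), A.indicator (fun _ => (1 : ℂ)) s / ((s : ℂ) - (x : ℂ))) +
      (∫ s in (x + ε)..(1 : ℝ), A.indicator (fun _ => (1 : ℂ)) s / ((s : ℂ) - (x : ℂ)))))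
      (nhdsWithin 0 (Ioi 0)) (nhds ((y / Real.pi : ℝ) : ℂ)) := by
    have h1 := ((Complex.continuous_ofReal.tendsto y).comp hy).const_mul (Real.pi : ℂ)⁻¹
    rw [← div_eq_inv_mul, ← Complex.ofReal_div] at h1
    refine h1.congr' ?_
    have hx1 := hsub hxA
    have hlt : (0 : ℝ) < min (x + 1) (1 - x) := lt_min (by linarith [hx1.1]) (by linarith [hx1.2])
    filter_upwards [Ioo_mem_nhdsGT hlt] with ε hε
    have hε1 := hε.2.trans_le (min_le_left _ _)
    have hε2 := hε.2.trans_le (min_le_right _ _)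
    rw [integral_div_sub_eq_integral_truncKernel hA hsub hε.1 (by linarith) (by linarith),
      Function.comp_apply]
  have hex : ∃ L : ℂ, Tendsto (fun ε : ℝ => (Real.pi : ℂ)⁻¹ *
      ((∫ s in (-1 : ℝ)..(x - ε), A.indicator (fun _ => (1 : ℂ)) s / ((s : ℂ) - (x : ℂ))) +
      (∫ s in (x + ε)..(1 : ℝ), A.indicator (fun _ => (1 : ℂ)) s / ((s : ℂ) - (x : ℂ)))))
      (nhdsWithin 0 (Ioi 0)) (nhds L) := ⟨_, hlim⟩
  rw [finiteHilbertT, dif_pos hex]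
  exact tendsto_nhds_unique hex.choose_spec hlim

/-- The finite Hilbert transform of the indicator of `A` has modulus at least one on a fixed
proportion of `A`. -/
theorem volume_le_lintegral_finiteHilbertT {A : Set ℝ} (hA : MeasurableSet A)
    (hsub : A ⊆ Ioo (-1) 1) {p : ℝ} (hp : 0 < p) :
    ENNReal.ofReal (2 / (Real.exp Real.pi + 1)) * volume A ≤
      ∫⁻ x in A, ‖finiteHilbertT (A.indicator fun _ => (1 : ℂ)) x‖ₑ ^ p := by
  obtain ⟨g, hgm, hg, hgA, hvol⟩ := exists_limit_gridLog hA hsub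
  have hB : MeasurableSet {x | x ∈ A ∧ Real.pi ≤ |g x|} :=
    hA.inter (measurableSet_le measurable_const hgm.abs)
  refine hvol.trans ?_
  calc volume {x | x ∈ A ∧ Real.pi ≤ |g x|}
      = ∫⁻ _ in {x | x ∈ A ∧ Real.pi ≤ |g x|}, 1 := (setLIntegral_one _).symm
    _ ≤ ∫⁻ x in {x | x ∈ A ∧ Real.pi ≤ |g x|},
        ‖finiteHilbertT (A.indicator fun _ => (1 : ℂ)) x‖ₑ ^ p := by
      refine lintegral_mono_ae ((ae_restrict_iff' hB).2 ?_)
      filter_upwards [ae_tendsto_integral_truncKernel hA hsub hg hgA] with x hx hxB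
      rw [finiteHilbertT_eq_of_tendsto hA hsub hxB.1 (hx hxB.1)]
      refine ENNReal.one_le_rpow ?_ hp
      rw [← ofReal_norm, Complex.norm_real, Real.norm_eq_abs, ENNReal.one_le_ofReal, abs_div,
        abs_of_pos Real.pi_pos, one_le_div Real.pi_pos]
      exact hxB.2
    _ ≤ _ := lintegral_mono_set fun x hx => hx.1

theorem enorm_sum_mul_indicator_rpow {ι : Type*} [Fintype ι] (a : ι → ℂ) {A : ι → Set ℝ}
    (hdisj : Pairwise (Function.onFun Disjoint A)) {p : ℝ} (hp : 0 < p) (x : ℝ) :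
    ‖∑ n, a n * (A n).indicator (fun _ => (1 : ℂ)) x‖ₑ ^ p =
      ∑ n, (A n).indicator (fun _ => ‖a n‖ₑ ^ p) x := by
  by_cases hx : ∃ n, x ∈ A n
  · obtain ⟨n, hn⟩ := hx
    have hother : ∀ m ≠ n, x ∉ A m := fun m hm h =>
      (disjoint_left.1 (hdisj hm) h) hn
    rw [Fintype.sum_eq_single n fun m hm => by simp [hother m hm],
      Fintype.sum_eq_single n fun m hm => by simp [hother m hm]]
    simp [hn]
  · push Not at hx
    simp [hx, hp]

end HilbertTransform

/-- With `δ = 2/(e^π + 1)`, for pairwise disjoint Borel sets `A₁,…,A_N ⊆ (-1,1)`: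
`‖(∑ |aₙ|² |T χ_{Aₙ}|²)^{1/2}‖_p ≥ δ^{1/p} ‖∑ aₙ χ_{Aₙ}‖_p`. -/
theorem stmt8 (p : ℝ) (hp : 1 < p) (N : ℕ) (a : Fin N → ℂ) (A : Fin N → Set ℝ)
    (hA : ∀ n, MeasurableSet (A n)) (hsub : ∀ n, A n ⊆ Set.Ioo (-1 : ℝ) 1)
    (hdisj : Pairwise (Function.onFun Disjoint A)) :
    ENNReal.ofReal ((2 / (Real.exp Real.pi + 1)) ^ (1 / p)) *
        eLpNorm (fun x => ∑ n, a n * (A n).indicator (fun _ => (1 : ℂ)) x)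
          (ENNReal.ofReal p) m11 ≤
      eLpNorm (fun x => Real.sqrt (∑ n,
          ‖a n‖ ^ 2 * ‖finiteHilbertT ((A n).indicator fun _ => (1 : ℂ)) x‖ ^ 2))
        (ENNReal.ofReal p) m11 := by
  have hp0 : 0 < p := by linarith
  have hδ : 0 < 2 / (Real.exp Real.pi + 1) := by positivity
  have hpz : ENNReal.ofReal p ≠ 0 := by simpa using hp0
  rw [eLpNorm_eq_lintegral_rpow_enorm_toReal hpz ENNReal.ofReal_ne_top,
    eLpNorm_eq_lintegral_rpow_enorm_toReal hpz ENNReal.ofReal_ne_top,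
    ENNReal.toReal_ofReal hp0.le, ← ENNReal.ofReal_rpow_of_pos hδ,
    ← ENNReal.mul_rpow_of_nonneg _ _ (by positivity)]
  refine ENNReal.rpow_le_rpow ?_ (by positivity)
  simp only [enorm_sum_mul_indicator_rpow a hdisj hp0]
  rw [lintegral_finsetSum _ fun n _ => measurable_const.indicator (hA n), Finset.mul_sum]
  calc ∑ n, ENNReal.ofReal (2 / (Real.exp Real.pi + 1)) *
        ∫⁻ x, (A n).indicator (fun _ => ‖a n‖ₑ ^ p) x ∂m11
      ≤ ∑ n, ∫⁻ x in A n, ‖Real.sqrt (∑ n, ‖a n‖ ^ 2 *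
          ‖finiteHilbertT ((A n).indicator fun _ => (1 : ℂ)) x‖ ^ 2)‖ₑ ^ p ∂m11 := by
        refine Finset.sum_le_sum fun n _ => ?_
        have hm : m11.restrict (A n) = volume.restrict (A n) := by
          rw [m11, Measure.restrict_restrict (hA n), inter_eq_self_of_subset_left (hsub n)]
        rw [lintegral_indicator (hA n), hm, setLIntegral_const, mul_left_comm]
        calc _ ≤ ‖a n‖ₑ ^ p * ∫⁻ x in A n,
              ‖finiteHilbertT ((A n).indicator fun _ => (1 : ℂ)) x‖ₑ ^ p := by
              gcongr
              exact volume_le_lintegral_finiteHilbertT (hA n) (hsub n) hp0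
          _ = ∫⁻ x in A n, ‖a n‖ₑ ^ p *
              ‖finiteHilbertT ((A n).indicator fun _ => (1 : ℂ)) x‖ₑ ^ p :=
              (lintegral_const_mul' _ _ (by finiteness)).symm
          _ ≤ _ := by
              refine lintegral_mono fun x => ?_
              rw [← ENNReal.mul_rpow_of_nonneg _ _ hp0.le]
              refine ENNReal.rpow_le_rpow ?_ hp0.le
              rw [← enorm_mul, ← ofReal_norm, ← ofReal_norm, Real.norm_eq_abs,
                abs_of_nonneg (Real.sqrt_nonneg _)]
              refine ENNReal.ofReal_le_ofReal (Real.le_sqrt_of_sq_le ?_)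
              rw [norm_mul, mul_pow]
              exact Finset.single_le_sum (f := fun n => ‖a n‖ ^ 2 *
                ‖finiteHilbertT ((A n).indicator fun _ => (1 : ℂ)) x‖ ^ 2)
                (fun m _ => by positivity) (Finset.mem_univ n)
    _ = ∫⁻ x in ⋃ n, A n, ‖Real.sqrt (∑ n, ‖a n‖ ^ 2 *
          ‖finiteHilbertT ((A n).indicator fun _ => (1 : ℂ)) x‖ ^ 2)‖ₑ ^ p ∂m11 := by
        rw [lintegral_iUnion hA hdisj, tsum_fintype]
    _ ≤ _ := setLIntegral_le_lintegral _ _
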